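/- arXiv:1307.6514 — 2 statements merged into one kernel-verified Lean document; each statement's English description precedes it below -/
import Mathlib

section
/- A three-dimensional reflexive polytope Δ can serve as the reflexive boundary of a four-dimensional short top whose dual top has the point (0,0,0,-1) in the interior of a two-face if and only if the polar dual Δ° can be decomposed as a union of two three-dimensional tops glued along a common two-dimensional reflexive polygon through the origin. -/
open Finset Matrix Pointwise
open scoped Classical

noncomputable section

namespace SemistableTops

/-- A point of `ℝ^k` with all integer coordinates. -/
def IsLatticePt {k : ℕ} (x : Fin k → ℝ) : Prop := ∀ i, ∃ n : ℤ, x i = (n : ℝ)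

/-- The lattice points lying in a subset of `ℝ^k`. -/
def latticePts {k : ℕ} (S : Set (Fin k → ℝ)) : Set (Fin k → ℝ) := {x ∈ S | IsLatticePt x}

/-- The polar dual `{y : x ⬝ y ≥ -1 for all x ∈ S}`. -/
def polarDual {k : ℕ} (S : Set (Fin k → ℝ)) : Set (Fin k → ℝ) :=
  {y | ∀ x ∈ S, -1 ≤ ∑ i, x i * y i}

/-- A lattice polytope: the convex hull of finitely many lattice points. -/
def IsLatticePolytope {k : ℕ} (S : Set (Fin k → ℝ)) : Prop :=
  ∃ V : Finset (Fin k → ℝ), (∀ v ∈ V, IsLatticePt v) ∧ S = convexHull ℝ (V : Set (Fin k → ℝ))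

/-- A reflexive polytope: a lattice polytope containing the origin whose polar dual is
again a lattice polytope. -/
def IsReflexive {k : ℕ} (S : Set (Fin k → ℝ)) : Prop :=
  IsLatticePolytope S ∧ (0 : Fin k → ℝ) ∈ S ∧ IsLatticePolytope (polarDual S)

/-- `F` is a `d`-dimensional exposed face of `P`, cut out by a supporting hyperplane. -/
def IsFace {k : ℕ} (P F : Set (Fin k → ℝ)) (d : ℕ) : Prop :=
  ∃ (n : Fin k → ℝ) (c : ℝ), n ≠ 0 ∧ (∀ x ∈ P, c ≤ ∑ i, n i * x i) ∧
    F = {x ∈ P | ∑ i, n i * x i = c} ∧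
    Module.finrank ℝ (affineSpan ℝ F).direction = d

/-- Forget the last coordinate. -/
def projInit {k : ℕ} (x : Fin (k+1) → ℝ) : Fin k → ℝ := fun i => x i.castSucc

/-- The last coordinate. -/
def lastCoord {k : ℕ} (x : Fin (k+1) → ℝ) : ℝ := x (Fin.last k)

/-- The point `(0, …, 0, -1)`. -/
def negE (k : ℕ) : Fin (k+1) → ℝ := fun i => if i = Fin.last k then -1 else 0

/-- A `(k+1)`-dimensional top: a lattice polytope in the half-space `x_{k+1} ≥ 0`, whose
facet in the hyperplane `x_{k+1} = 0` is a `k`-dimensional reflexive polytope, and whose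
other facets lie on hyperplanes `n ⬝ x = -1` with `n` a lattice point. -/
structure IsTopPoly {k : ℕ} (Δ : Set (Fin (k+1) → ℝ)) : Prop where
  poly : IsLatticePolytope Δ
  halfspace : ∀ x ∈ Δ, 0 ≤ lastCoord x
  facets : ∃ N : Finset (Fin (k+1) → ℝ), (∀ n ∈ N, IsLatticePt n) ∧
      Δ = {x | 0 ≤ lastCoord x} ∩ ⋂ n ∈ N, {x | -1 ≤ ∑ i, n i * x i}
  reflexive_boundary : IsReflexive (projInit '' (Δ ∩ {x | lastCoord x = 0}))

/-- The summit of a top: its intersection with the half-space `x_{k+1} ≥ 1`. -/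
def summit {k : ℕ} (Δ : Set (Fin (k+1) → ℝ)) : Set (Fin (k+1) → ℝ) :=
  Δ ∩ {x | 1 ≤ lastCoord x}

/-- A short top: a top all of whose summit lattice points lie at height `1`. -/
def IsShortTop {k : ℕ} (Δ : Set (Fin (k+1) → ℝ)) : Prop :=
  IsTopPoly Δ ∧ ∀ x ∈ latticePts (summit Δ), lastCoord x = 1

/-- A lattice-preserving linear isomorphism of `ℝ^k` (an element of `GL_k(ℤ)`). -/
def UnimodularMap {k : ℕ} (φ : (Fin k → ℝ) → (Fin k → ℝ)) : Prop :=
  ∃ M : Matrix (Fin k) (Fin k) ℤ, IsUnit M.det ∧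
    ∀ x, φ x = (M.map (fun z : ℤ => (z : ℝ))).mulVec x

/-- The vertical ray `{t • e_{k+1} : t ≥ 0}`. -/
def upRay (n : ℕ) : Set (Fin (n+1) → ℝ) :=
  {x | ∃ t : ℝ, 0 ≤ t ∧ x = fun i => if i = Fin.last n then t else 0}

/-! ### Polar duality -/

section Polar

variable {k : ℕ}

lemma mem_polarDual {S : Set (Fin k → ℝ)} {y : Fin k → ℝ} :
    y ∈ polarDual S ↔ ∀ x ∈ S, -1 ≤ x ⬝ᵥ y := Iff.rfl

lemma zero_mem_polarDual (S : Set (Fin k → ℝ)) : (0 : Fin k → ℝ) ∈ polarDual S := by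
  intro x _
  simp

lemma polarDual_anti {S T : Set (Fin k → ℝ)} (h : S ⊆ T) : polarDual T ⊆ polarDual S :=
  fun _ hy x hx => hy x (h hx)

lemma subset_polarDual_polarDual (S : Set (Fin k → ℝ)) : S ⊆ polarDual (polarDual S) := by
  intro x hx y hy
  have h := mem_polarDual.1 hy x hx
  rwa [dotProduct_comm] at h

lemma convex_dotProduct_ge (u : Fin k → ℝ) (c : ℝ) : Convex ℝ {x : Fin k → ℝ | c ≤ u ⬝ᵥ x} :=
  convex_halfSpace_ge (dotProductBilin ℝ ℝ u).isLinear c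

lemma dotProduct_ge_of_mem_convexHull {S : Set (Fin k → ℝ)} {u x : Fin k → ℝ} {c : ℝ}
    (h : ∀ v ∈ S, c ≤ u ⬝ᵥ v) (hx : x ∈ convexHull ℝ S) : c ≤ u ⬝ᵥ x :=
  convexHull_min (fun v hv => h v hv) (convex_dotProduct_ge u c) hx

lemma polarDual_convexHull (S : Set (Fin k → ℝ)) :
    polarDual (convexHull ℝ S) = polarDual S := by
  apply Set.Subset.antisymm
  · exact polarDual_anti (subset_convexHull ℝ _)
  · intro y hy x hx
    change -1 ≤ x ⬝ᵥ y
    rw [dotProduct_comm]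
    refine dotProduct_ge_of_mem_convexHull (fun v hv => ?_) hx
    rw [dotProduct_comm]
    exact hy v hv

lemma polarDual_convexHull_insert_zero (S : Set (Fin k → ℝ)) :
    polarDual (convexHull ℝ (insert 0 S)) = polarDual S := by
  rw [polarDual_convexHull]
  refine Set.Subset.antisymm (polarDual_anti (Set.subset_insert _ _)) fun y hy => ?_
  rintro x (rfl | hx)
  · simp
  · exact hy x hx

lemma exists_dotProduct_eq (f : (Fin k → ℝ) →ₗ[ℝ] ℝ) : ∃ u : Fin k → ℝ, ∀ x, f x = u ⬝ᵥ x := by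
  refine ⟨fun i => f fun j => if i = j then 1 else 0, fun x => ?_⟩
  rw [LinearMap.pi_apply_eq_sum_univ f x]
  exact Finset.sum_congr rfl fun i _ => by rw [smul_eq_mul, mul_comm]

/-- The bipolar theorem. -/
lemma polarDual_polarDual {S : Set (Fin k → ℝ)} (hc : Convex ℝ S) (hcl : IsClosed S)
    (h0 : (0 : Fin k → ℝ) ∈ S) : polarDual (polarDual S) = S := by
  apply Set.Subset.antisymm _ (subset_polarDual_polarDual S)
  intro p hp
  by_contra hpS
  obtain ⟨f, c, hfp, hfS⟩ := geometric_hahn_banach_point_closed hc hcl hpS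
  obtain ⟨u, hu⟩ := exists_dotProduct_eq (f : (Fin k → ℝ) →ₗ[ℝ] ℝ)
  replace hu : ∀ x, f x = u ⬝ᵥ x := hu
  have hc0 : c < 0 := by simpa using hfS 0 h0
  have hmem : (-c)⁻¹ • u ∈ polarDual S := by
    intro x hx
    change -1 ≤ x ⬝ᵥ _
    rw [dotProduct_smul, smul_eq_mul, dotProduct_comm, ← hu, inv_mul_eq_div,
      le_div_iff₀ (by linarith)]
    linarith [hfS x hx]
  have h := mem_polarDual.1 hp _ hmem
  rw [smul_dotProduct, smul_eq_mul, ← hu, inv_mul_eq_div, le_div_iff₀ (by linarith)] at h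
  linarith

lemma exists_pos_forall_norm_le_mem_polarDual {S : Set (Fin k → ℝ)}
    (hS : Bornology.IsBounded S) : ∃ r > 0, ∀ y : Fin k → ℝ, ‖y‖ ≤ r → y ∈ polarDual S := by
  obtain ⟨C, hC0, hC⟩ := hS.exists_pos_norm_le
  refine ⟨(k * C + 1)⁻¹, by positivity, fun y hy x hx => ?_⟩
  have h1 : |∑ i, x i * y i| ≤ ∑ _i : Fin k, C * (k * C + 1)⁻¹ := by
    refine (Finset.abs_sum_le_sum_abs _ _).trans (Finset.sum_le_sum fun i _ => ?_)
    rw [abs_mul]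
    exact mul_le_mul ((norm_le_pi_norm x i).trans (hC x hx)) ((norm_le_pi_norm y i).trans hy)
      (abs_nonneg _) hC0.le
  have h2 : ∑ _i : Fin k, C * (k * C + 1 : ℝ)⁻¹ ≤ 1 := by
    rw [Finset.sum_const, Finset.card_univ, Fintype.card_fin, nsmul_eq_mul, ← mul_assoc,
      ← div_eq_mul_inv, div_le_one (by positivity)]
    linarith
  linarith [neg_abs_le (∑ i, x i * y i)]

lemma exists_smul_mem_polarDual {S : Set (Fin k → ℝ)} (hS : Bornology.IsBounded S)
    (y : Fin k → ℝ) : ∃ ε : ℝ, 0 < ε ∧ ε • y ∈ polarDual S := by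
  obtain ⟨r, hr, h⟩ := exists_pos_forall_norm_le_mem_polarDual hS
  refine ⟨r / (‖y‖ + 1), by positivity, h _ ?_⟩
  rw [norm_smul, Real.norm_of_nonneg (by positivity), div_mul_eq_mul_div,
    div_le_iff₀ (by positivity)]
  nlinarith [norm_nonneg y]

lemma eq_zero_of_forall_mem_polarDual {S : Set (Fin k → ℝ)} (hS : Bornology.IsBounded S)
    {u : Fin k → ℝ} (h : ∀ y ∈ polarDual S, 0 ≤ u ⬝ᵥ y) : u = 0 := by
  obtain ⟨ε, hε, hmem⟩ := exists_smul_mem_polarDual hS (-u)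
  have h1 := h _ hmem
  rw [dotProduct_smul, dotProduct_neg, smul_eq_mul, mul_neg] at h1
  have h2 : 0 ≤ u ⬝ᵥ u := Finset.sum_nonneg fun i _ => mul_self_nonneg _
  have h3 : u ⬝ᵥ u ≤ 0 := by
    by_contra! h4
    linarith [mul_pos hε h4]
  exact dotProduct_self_eq_zero.1 (le_antisymm h3 h2)

end Polar

/-! ### Lattice polytopes -/

section Lattice

variable {k l : ℕ}

lemma IsLatticePt.zero : IsLatticePt (0 : Fin k → ℝ) := fun _ => ⟨0, by simp⟩

lemma IsLatticePt.intCast (m : Fin k → ℤ) : IsLatticePt fun i => (m i : ℝ) := fun i => ⟨m i, rfl⟩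

lemma IsLatticePt.exists_intCast {x : Fin k → ℝ} (h : IsLatticePt x) :
    ∃ m : Fin k → ℤ, x = fun i => (m i : ℝ) := by
  choose m hm using h
  exact ⟨m, funext hm⟩

lemma IsLatticePt.dotProduct {x y : Fin k → ℝ} (hx : IsLatticePt x) (hy : IsLatticePt y) :
    ∃ n : ℤ, x ⬝ᵥ y = n := by
  obtain ⟨a, rfl⟩ := hx.exists_intCast
  obtain ⟨b, rfl⟩ := hy.exists_intCast
  exact ⟨a ⬝ᵥ b, by simp [_root_.dotProduct]⟩

lemma IsLatticePt.mulVec {x : Fin k → ℝ} (hx : IsLatticePt x) (M : Matrix (Fin l) (Fin k) ℤ) :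
    IsLatticePt ((M.map (fun z : ℤ => (z : ℝ))).mulVec x) :=
  fun i => IsLatticePt.dotProduct (IsLatticePt.intCast (M i)) hx

lemma IsLatticePt.vecMul {x : Fin k → ℝ} (hx : IsLatticePt x) (M : Matrix (Fin k) (Fin l) ℤ) :
    IsLatticePt (x ᵥ* M.map (fun z : ℤ => (z : ℝ))) := by
  rw [← mulVec_transpose, ← transpose_map]
  exact hx.mulVec _

lemma IsLatticePt.projInit {x : Fin (k + 1) → ℝ} (hx : IsLatticePt x) :
    IsLatticePt (projInit x) := fun i => hx i.castSucc

lemma IsLatticePt.snoc {x : Fin k → ℝ} (hx : IsLatticePt x) {h : ℝ} (hh : ∃ n : ℤ, h = n) :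
    IsLatticePt (Fin.snoc x h : Fin (k + 1) → ℝ) := by
  intro i
  refine Fin.lastCases ?_ (fun j => ?_) i
  · simpa using hh
  · simpa using hx j

lemma IsLatticePolytope.convex {S : Set (Fin k → ℝ)} (h : IsLatticePolytope S) : Convex ℝ S := by
  obtain ⟨V, -, rfl⟩ := h
  exact convex_convexHull ℝ _

lemma IsLatticePolytope.isCompact {S : Set (Fin k → ℝ)} (h : IsLatticePolytope S) :
    IsCompact S := by
  obtain ⟨V, -, rfl⟩ := h
  exact V.finite_toSet.isCompact_convexHull ℝ

lemma isLatticePolytope_convexHull_insert_zero {W : Set (Fin k → ℝ)} (hW : W.Finite)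
    (hWl : ∀ w ∈ W, IsLatticePt w) : IsLatticePolytope (convexHull ℝ (insert 0 W)) := by
  refine ⟨(hW.insert 0).toFinset, fun v hv => ?_, by simp⟩
  rcases (Set.Finite.mem_toFinset _).1 hv with rfl | hv
  · exact IsLatticePt.zero
  · exact hWl v hv

lemma IsLatticePolytope.image {S : Set (Fin k → ℝ)} (h : IsLatticePolytope S)
    (f : (Fin k → ℝ) →ₗ[ℝ] (Fin l → ℝ)) (hf : ∀ x, IsLatticePt x → IsLatticePt (f x)) :
    IsLatticePolytope (f '' S) := by
  obtain ⟨V, hV, rfl⟩ := h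
  refine ⟨V.image f, fun v hv => ?_, ?_⟩
  · obtain ⟨x, hx, rfl⟩ := Finset.mem_image.1 hv
    exact hf x (hV x hx)
  · rw [LinearMap.image_convexHull, Finset.coe_image]

lemma IsLatticePolytope.image_mulVec {S : Set (Fin k → ℝ)} (h : IsLatticePolytope S)
    (M : Matrix (Fin l) (Fin k) ℤ) :
    IsLatticePolytope ((M.map (fun z : ℤ => (z : ℝ))).mulVec '' S) :=
  h.image (M.map (fun z : ℤ => (z : ℝ))).mulVecLin fun _ hx => hx.mulVec M

/-- `projInit` as a linear map. -/
def projInitL (k : ℕ) : (Fin (k + 1) → ℝ) →ₗ[ℝ] (Fin k → ℝ) := LinearMap.funLeft ℝ ℝ Fin.castSucc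

lemma IsLatticePolytope.image_projInit {S : Set (Fin (k + 1) → ℝ)} (h : IsLatticePolytope S) :
    IsLatticePolytope (projInit '' S) :=
  h.image (projInitL k) fun _ hx => hx.projInit

/-- The faces of a lattice polytope are lattice polytopes. -/
lemma IsLatticePolytope.face {S : Set (Fin k → ℝ)} (h : IsLatticePolytope S) {u : Fin k → ℝ}
    {c : ℝ} (hu : ∀ x ∈ S, c ≤ u ⬝ᵥ x) : IsLatticePolytope {x ∈ S | u ⬝ᵥ x = c} := by
  obtain ⟨V, hV, rfl⟩ := h
  refine ⟨V.filter fun v => u ⬝ᵥ v = c, fun v hv => hV v (Finset.mem_filter.1 hv).1, ?_⟩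
  apply Set.Subset.antisymm
  · rintro x ⟨hx, hxc⟩
    obtain ⟨w, hw0, hw1, rfl⟩ := Finset.mem_convexHull'.1 hx
    have hsum : ∑ v ∈ V, w v * (u ⬝ᵥ v - c) = 0 := by
      simp only [mul_sub, Finset.sum_sub_distrib, ← Finset.sum_mul, hw1]
      simp only [dotProduct_sum, dotProduct_smul, smul_eq_mul] at hxc
      linarith
    have hz := (Finset.sum_eq_zero_iff_of_nonneg fun v hv => mul_nonneg (hw0 v hv)
      (sub_nonneg.2 (hu v (subset_convexHull ℝ _ hv)))).1 hsum
    have hw : ∀ v ∈ V, w v ≠ 0 → u ⬝ᵥ v = c := fun v hv hne => by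
      rcases mul_eq_zero.1 (hz v hv) with h | h
      · exact absurd h hne
      · linarith
    refine Finset.mem_convexHull'.2 ⟨w, fun v hv => hw0 v (Finset.mem_filter.1 hv).1, ?_, ?_⟩
    · rw [Finset.sum_filter_of_ne hw, hw1]
    · exact Finset.sum_filter_of_ne fun v hv hne => hw v hv fun h => hne (by rw [h, zero_smul])
  · intro x hx
    refine ⟨convexHull_mono (Finset.coe_subset.2 (Finset.filter_subset _ _)) hx, ?_⟩
    refine convexHull_min (t := {x | u ⬝ᵥ x = c}) (fun v hv => ?_)
      (convex_hyperplane (dotProductBilin ℝ ℝ u).isLinear c) hx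
    exact (Finset.mem_filter.1 hv).2

end Lattice

/-! ### Unimodular changes of coordinates -/

lemma exists_bezout (p q : ℤ) :
    ∃ g p' q' u v : ℤ, 0 ≤ g ∧ p = g * p' ∧ q = g * q' ∧ u * p' + v * q' = 1 := by
  by_cases h : p = 0 ∧ q = 0
  · exact ⟨0, 1, 0, 1, 0, le_rfl, by simp [h.1], by simp [h.2], by norm_num⟩
  · have hg : 0 < Int.gcd p q := by
      rw [Nat.pos_iff_ne_zero, Ne, Int.gcd_eq_zero_iff]
      exact h
    obtain ⟨p', hp⟩ := Int.gcd_dvd_left (a := p) (b := q)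
    obtain ⟨q', hq⟩ := Int.gcd_dvd_right (a := p) (b := q)
    refine ⟨Int.gcd p q, p', q', Int.gcdA p q, Int.gcdB p q, by positivity, hp, hq, ?_⟩
    have hb := Int.gcd_eq_gcd_ab p q
    have hg' : (Int.gcd p q : ℤ) ≠ 0 := by positivity
    apply mul_left_cancel₀ hg'
    linear_combination (-1 : ℤ) * hb - Int.gcdA p q * hp - Int.gcdB p q * hq

/-- A nonzero integer vector is a positive multiple of the last row of a unimodular matrix. -/
lemma exists_isUnit_det_last_row {m : Fin 3 → ℤ} (hm : m ≠ 0) :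
    ∃ (M : Matrix (Fin 3) (Fin 3) ℤ) (d : ℤ), IsUnit M.det ∧ 0 < d ∧ m = d • M (Fin.last 2) := by
  obtain ⟨g, p, q, u, v, -, hp, hq, huv⟩ := exists_bezout (m 0) (m 1)
  obtain ⟨d, g', r, s, t, hd, hg, hr, hst⟩ := exists_bezout g (m 2)
  have hrow : m = d • ![g' * p, g' * q, r] := by
    ext i
    fin_cases i
    · simp [hp, hg, mul_assoc]
    · simp [hq, hg, mul_assoc]
    · simp [hr]
  refine ⟨!![-v, u, 0; -t * p, -t * q, s; g' * p, g' * q, r], d, ?_, ?_, hrow⟩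
  · have : (!![-v, u, 0; -t * p, -t * q, s; g' * p, g' * q, r] : Matrix (Fin 3) (Fin 3) ℤ).det
        = 1 := by
      rw [det_fin_three]
      simp
      linear_combination (g' * s + r * t) * huv + hst
    rw [this]
    exact isUnit_one
  · refine lt_of_le_of_ne hd fun h => hm ?_
    rw [hrow, ← h, zero_smul]

lemma dotProduct_eq_sum_projInit {k : ℕ} (x y : Fin (k + 1) → ℝ) :
    x ⬝ᵥ y = projInit x ⬝ᵥ projInit y + lastCoord x * lastCoord y :=
  Fin.sum_univ_castSucc _

@[simp] lemma projInit_snoc {k : ℕ} (y : Fin k → ℝ) (h : ℝ) :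
    projInit (Fin.snoc y h : Fin (k + 1) → ℝ) = y :=
  funext fun i => Fin.snoc_castSucc (α := fun _ => ℝ) h y i

@[simp] lemma lastCoord_snoc {k : ℕ} (y : Fin k → ℝ) (h : ℝ) :
    lastCoord (Fin.snoc y h : Fin (k + 1) → ℝ) = h :=
  Fin.snoc_last (α := fun _ => ℝ) h y

lemma snoc_projInit_lastCoord {k : ℕ} (x : Fin (k + 1) → ℝ) :
    (Fin.snoc (projInit x) (lastCoord x) : Fin (k + 1) → ℝ) = x := by
  exact Fin.snoc_init_self (α := fun _ => ℝ) x

/-- A section of `{lastCoord = 0}`, identified with a subset of a space of lower dimension. -/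
lemma eq_image_snoc_image_projInit {k : ℕ} {S : Set (Fin (k + 1) → ℝ)}
    (hS : ∀ x ∈ S, lastCoord x = 0) :
    S = (fun v => (Fin.snoc v 0 : Fin (k + 1) → ℝ)) '' (projInit '' S) := by
  rw [Set.image_image]
  refine (Set.EqOn.image_eq_self fun x hx => ?_).symm
  have h := snoc_projInit_lastCoord x
  rwa [hS x hx] at h

lemma map_intCast_mul_eq_one {k : ℕ} {M N : Matrix (Fin k) (Fin k) ℤ} (h : M * N = 1) :
    M.map (fun z : ℤ => (z : ℝ)) * N.map (fun z : ℤ => (z : ℝ)) = 1 := by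
  change M.map (Int.castRingHom ℝ) * N.map (Int.castRingHom ℝ) = 1
  rw [← Matrix.map_mul, h, Matrix.map_one _ (map_zero _) (map_one _)]

/-- Unimodular maps reflect lattice polytopes. -/
lemma UnimodularMap.isLatticePolytope_of_image {k : ℕ} {φ : (Fin k → ℝ) → (Fin k → ℝ)}
    (hφ : UnimodularMap φ) {S : Set (Fin k → ℝ)} (h : IsLatticePolytope (φ '' S)) :
    IsLatticePolytope S := by
  obtain ⟨M, hM, hφM⟩ := hφ
  have h' := h.image_mulVec M⁻¹
  rw [Set.image_image] at h'
  convert h' using 1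
  symm
  convert Set.image_id S using 2 with x
  ext x
  rw [hφM, mulVec_mulVec, map_intCast_mul_eq_one (nonsing_inv_mul M hM), one_mulVec, id]

/-- If a half of the dual of a lattice polytope `Δ` is a lattice polytope, then it is isomorphic
to a top, by an isomorphism that flattens the cutting plane. -/
lemma exists_isTopPoly_half {Δ : Set (Fin 3 → ℝ)} (hΔ : IsLatticePolytope Δ) {m : Fin 3 → ℤ}
    (hm : m ≠ 0)
    (hA : IsLatticePolytope (polarDual Δ ∩ {x | 0 ≤ ∑ i, (m i : ℝ) * x i})) :
    ∃ φ : (Fin 3 → ℝ) → (Fin 3 → ℝ), UnimodularMap φ ∧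
      (∀ x, lastCoord (k := 2) (φ x) = 0 ↔ ∑ i, (m i : ℝ) * x i = 0) ∧
      IsTopPoly (k := 2) (φ '' (polarDual Δ ∩ {x | 0 ≤ ∑ i, (m i : ℝ) * x i})) := by
  obtain ⟨M, d, hM, hd, hmd⟩ := exists_isUnit_det_last_row hm
  obtain ⟨V, hV, rfl⟩ := hΔ
  set A := polarDual (convexHull ℝ (V : Set (Fin 3 → ℝ))) ∩ {x | 0 ≤ ∑ i, (m i : ℝ) * x i}
    with hAdef
  set MR := M.map (fun z : ℤ => (z : ℝ)) with hMR
  set MI := M⁻¹.map (fun z : ℤ => (z : ℝ)) with hMI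
  have hinv : MI * MR = 1 := map_intCast_mul_eq_one (nonsing_inv_mul M hM)
  have hinv' : MR * MI = 1 := map_intCast_mul_eq_one (mul_nonsing_inv M hM)
  have hdR : (0 : ℝ) < d := by exact_mod_cast hd
  have hlast : ∀ x, ∑ i, (m i : ℝ) * x i = d * lastCoord (k := 2) (MR.mulVec x) := by
    intro x
    have h1 : lastCoord (k := 2) (MR.mulVec x) = ∑ i, (M (Fin.last 2) i : ℝ) * x i := rfl
    rw [h1, Finset.mul_sum]
    refine Finset.sum_congr rfl fun i _ => ?_
    rw [congrFun hmd i]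
    simp [mul_assoc]
  have hmemA : ∀ x, x ∈ A ↔ (∀ v ∈ V, -1 ≤ v ⬝ᵥ x) ∧ 0 ≤ lastCoord (k := 2) (MR.mulVec x) := by
    intro x
    rw [hAdef, polarDual_convexHull, Set.mem_inter_iff, Set.mem_ofPred_eq, hlast,
      mul_nonneg_iff_of_pos_left hdR]
    rfl
  have hmem : ∀ x, x ∈ MR.mulVec '' A ↔ MI.mulVec x ∈ A := by
    intro x
    constructor
    · rintro ⟨y, hy, rfl⟩
      rwa [mulVec_mulVec, hinv, one_mulVec]
    · intro h
      exact ⟨_, h, by rw [mulVec_mulVec, hinv', one_mulVec]⟩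
  set N := V.image fun v => v ᵥ* MI with hN
  have hNl : ∀ n ∈ N, IsLatticePt n := by
    intro n hn
    obtain ⟨v, hv, rfl⟩ := Finset.mem_image.1 hn
    exact (hV v hv).vecMul _
  have hmemP : ∀ x, x ∈ MR.mulVec '' A ↔ 0 ≤ lastCoord (k := 2) x ∧ ∀ n ∈ N, -1 ≤ n ⬝ᵥ x := by
    intro x
    rw [hmem, hmemA, mulVec_mulVec, hinv', one_mulVec, and_comm]
    simp [hN, dotProduct_mulVec]
  have hpoly : IsLatticePolytope (MR.mulVec '' A) := hA.image_mulVec M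
  refine ⟨MR.mulVec, ⟨M, hM, fun _ => rfl⟩, fun x => ?_, hpoly, fun x hx => ((hmemP x).1 hx).1,
    ⟨N, hNl, ?_⟩, ?_, ?_, ?_⟩
  · rw [hlast, mul_eq_zero, or_iff_right hdR.ne']
  · ext x
    rw [hmemP]
    simp [_root_.dotProduct]
  · have hface := hpoly.face (u := Fin.snoc (0 : Fin 2 → ℝ) 1) (c := 0) fun x hx => by
      rw [dotProduct_eq_sum_projInit]
      simpa using ((hmemP x).1 hx).1
    convert hface.image_projInit using 2
    ext x
    simp [dotProduct_eq_sum_projInit]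
  · exact ⟨0, ⟨(hmemP 0).2 ⟨le_rfl, fun n _ => by simp⟩, rfl⟩, rfl⟩
  · have hR : projInit '' (MR.mulVec '' A ∩ {x | lastCoord (k := 2) x = 0})
        = polarDual (projInit '' (N : Set (Fin 3 → ℝ))) := by
      ext z
      rw [mem_polarDual]
      constructor
      · rintro ⟨x, ⟨hx, hx0⟩, rfl⟩ _ ⟨n, hn, rfl⟩
        have h := ((hmemP x).1 hx).2 n hn
        rw [dotProduct_eq_sum_projInit (k := 2), show lastCoord (k := 2) x = 0 from hx0] at h
        simpa using h
      · intro h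
        refine ⟨Fin.snoc z 0, ⟨(hmemP _).2 ⟨by simp, fun n hn => ?_⟩, by simp⟩, by simp⟩
        rw [dotProduct_eq_sum_projInit (k := 2)]
        simpa using h _ ⟨n, hn, rfl⟩
    have hW := isLatticePolytope_convexHull_insert_zero
      (W := projInit '' (N : Set (Fin 3 → ℝ))) (N.finite_toSet.image _) (by
        rintro _ ⟨n, hn, rfl⟩
        exact IsLatticePt.projInit (k := 2) (hNl n hn))
    rw [hR, ← polarDual_convexHull_insert_zero (projInit '' _),
      polarDual_polarDual hW.convex hW.isCompact.isClosed (subset_convexHull ℝ _ (Set.mem_insert _ _))]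
    exact hW

/-! ### Tops and their duals -/

section Top

variable {k : ℕ}

lemma mem_upRay {x : Fin (k + 1) → ℝ} : x ∈ upRay k ↔ projInit x = 0 ∧ 0 ≤ lastCoord x := by
  constructor
  · rintro ⟨t, ht, rfl⟩
    refine ⟨funext fun i => ?_, ?_⟩
    · simp [projInit, Fin.castSucc_ne_last]
    · simpa [lastCoord] using ht
  · rintro ⟨h0, h⟩
    refine ⟨lastCoord x, h, funext fun i => ?_⟩
    refine Fin.lastCases ?_ (fun j => ?_) i
    · simp [lastCoord]
    · rw [if_neg (Fin.castSucc_ne_last j)]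
      exact congrFun h0 j

lemma zero_mem_upRay : (0 : Fin (k + 1) → ℝ) ∈ upRay k := mem_upRay.2 ⟨rfl, le_rfl⟩

lemma isClosed_upRay : IsClosed (upRay k) := by
  have : upRay k = {x | projInit x = 0} ∩ {x | 0 ≤ lastCoord x} := Set.ext fun x => mem_upRay
  rw [this]
  exact (isClosed_eq (continuous_pi fun i => continuous_apply i.castSucc) continuous_const).inter
    (isClosed_le continuous_const (continuous_apply _))

lemma convex_upRay : Convex ℝ (upRay k) := by
  intro x hx y hy a b ha hb _
  rw [mem_upRay] at *
  refine ⟨?_, add_nonneg (mul_nonneg ha hx.2) (mul_nonneg hb hy.2)⟩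
  change a • projInit x + b • projInit y = 0
  rw [hx.1, hy.1]
  simp

/-- The dual of a top is a polytope plus the vertical ray. -/
lemma polarDual_eq_convexHull_add_upRay {T : Set (Fin (k + 1) → ℝ)}
    {N : Finset (Fin (k + 1) → ℝ)}
    (hT : T = {x | 0 ≤ lastCoord x} ∩ ⋂ n ∈ N, {x | -1 ≤ ∑ i, n i * x i}) :
    polarDual T = convexHull ℝ (insert 0 (N : Set (Fin (k + 1) → ℝ))) + upRay k := by
  set W := convexHull ℝ (insert 0 (N : Set (Fin (k + 1) → ℝ))) with hW
  have h0W : (0 : Fin (k + 1) → ℝ) ∈ W := subset_convexHull ℝ _ (Set.mem_insert _ _)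
  have hTmem : ∀ x, x ∈ T ↔ 0 ≤ lastCoord x ∧ x ∈ polarDual W := by
    intro x
    rw [hW, polarDual_convexHull_insert_zero, mem_polarDual, hT]
    simp [_root_.dotProduct]
  have hTK : T = polarDual (W + upRay k) := by
    ext x
    rw [hTmem]
    constructor
    · rintro ⟨hx0, hx⟩ _ ⟨w, hw, r, hr, rfl⟩
      change -1 ≤ (w + r) ⬝ᵥ x
      rw [mem_upRay] at hr
      rw [add_dotProduct, dotProduct_eq_sum_projInit r, hr.1, zero_dotProduct]
      have h1 := mem_polarDual.1 hx w hw
      have h2 := mul_nonneg hr.2 hx0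
      linarith
    · intro hx
      refine ⟨?_, polarDual_anti (show W ⊆ W + upRay k from
        fun w hw => ⟨w, hw, 0, zero_mem_upRay, add_zero w⟩) hx⟩
      by_contra! hneg
      have hr : (Fin.snoc (0 : Fin k → ℝ) (2 / -lastCoord x) : Fin (k + 1) → ℝ) ∈ upRay k :=
        mem_upRay.2 ⟨by simp, by
          rw [lastCoord_snoc]; exact div_nonneg zero_le_two (by linarith)⟩
      have h := mem_polarDual.1 hx _ (Set.add_mem_add h0W hr)
      rw [zero_add, dotProduct_eq_sum_projInit, projInit_snoc, lastCoord_snoc, zero_dotProduct,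
        div_neg, neg_mul, div_mul_cancel₀ _ hneg.ne] at h
      linarith
  have hWc : IsCompact W := (N.finite_toSet.insert 0).isCompact_convexHull ℝ
  rw [hTK]
  exact polarDual_polarDual ((convex_convexHull ℝ _).add convex_upRay)
    (isClosed_upRay.add_left_of_isCompact hWc) ⟨0, h0W, 0, zero_mem_upRay, add_zero 0⟩

lemma projInit_mem_polarDual {T : Set (Fin (k + 1) → ℝ)} {p : Fin (k + 1) → ℝ}
    (hp : p ∈ polarDual T) :
    projInit p ∈ polarDual (projInit '' (T ∩ {x | lastCoord x = 0})) := by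
  rintro _ ⟨x, ⟨hx, hx0⟩, rfl⟩
  have h := mem_polarDual.1 hp x hx
  rw [dotProduct_eq_sum_projInit, show lastCoord x = 0 from hx0, zero_mul, add_zero] at h
  exact h

/-- If the lower boundary of the dual of a top agrees with an affine function on a half of the
dual of the reflexive boundary, then this half is a lattice polytope. -/
lemma IsTopPoly.isLatticePolytope_half {T : Set (Fin (k + 1) → ℝ)} (hT : IsTopPoly T)
    {a b : Fin k → ℝ} (ha : (Fin.snoc a 1 : Fin (k + 1) → ℝ) ∈ T)
    (hb : (Fin.snoc b 1 : Fin (k + 1) → ℝ) ∈ T)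
    (hab : ∀ y ∈ polarDual (projInit '' (T ∩ {x | lastCoord x = 0})), 0 ≤ (b - a) ⬝ᵥ y →
      (Fin.snoc y (-1 - a ⬝ᵥ y) : Fin (k + 1) → ℝ) ∈ polarDual T) :
    IsLatticePolytope (polarDual (projInit '' (T ∩ {x | lastCoord x = 0})) ∩
      {y | 0 ≤ (b - a) ⬝ᵥ y}) := by
  obtain ⟨N, hN, hTN⟩ := hT.facets
  have hdual := polarDual_eq_convexHull_add_upRay hTN
  set W := convexHull ℝ (insert 0 (N : Set (Fin (k + 1) → ℝ))) with hW
  have hWl : IsLatticePolytope W := isLatticePolytope_convexHull_insert_zero N.finite_toSet hN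
  have hWT : W ⊆ polarDual T := by
    rw [hdual]
    exact fun w hw => ⟨w, hw, 0, zero_mem_upRay, add_zero w⟩
  have hface := (hWl.face fun w hw => mem_polarDual.1 (hWT hw) _ ha).image_projInit
  convert hface using 1
  ext y
  constructor
  · rintro ⟨hy, hy0⟩
    have hp := hab y hy hy0
    rw [hdual] at hp
    obtain ⟨w, hw, r, hr, hwr⟩ := hp
    rw [mem_upRay] at hr
    have h1 := mem_polarDual.1 (hWT hw) _ ha
    have h2 : (Fin.snoc a 1 : Fin (k + 1) → ℝ) ⬝ᵥ (w + r) = -1 := by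
      rw [show w + r = _ from hwr, dotProduct_eq_sum_projInit]
      simp
    have h3 : (Fin.snoc a 1 : Fin (k + 1) → ℝ) ⬝ᵥ r = lastCoord r := by
      rw [dotProduct_eq_sum_projInit, hr.1]
      simp
    rw [dotProduct_add, h3] at h2
    refine ⟨w, ⟨hw, by linarith [hr.2]⟩, ?_⟩
    have h4 : projInit w + projInit r = y := by
      have := congrArg projInit hwr
      rwa [projInit_snoc] at this
    rwa [hr.1, add_zero] at h4
  · rintro ⟨p, ⟨hp, hpa⟩, rfl⟩
    have hpT : p ∈ polarDual T := hWT hp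
    refine ⟨projInit_mem_polarDual hpT, ?_⟩
    have hpb := mem_polarDual.1 hpT _ hb
    rw [dotProduct_eq_sum_projInit] at hpa hpb
    simp only [projInit_snoc, lastCoord_snoc] at hpa hpb
    change 0 ≤ (b - a) ⬝ᵥ projInit p
    rw [sub_dotProduct]
    linarith

end Top

/-! ### Linear algebra -/

section LinearAlgebra

variable {k : ℕ}

/-- The common kernel of two linear functionals. -/
def orthPair (u v : Fin k → ℝ) : Submodule ℝ (Fin k → ℝ) :=
  LinearMap.ker (Matrix.of ![u, v]).mulVecLin

lemma mem_orthPair {u v x : Fin k → ℝ} : x ∈ orthPair u v ↔ u ⬝ᵥ x = 0 ∧ v ⬝ᵥ x = 0 := by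
  rw [orthPair, LinearMap.mem_ker, mulVecLin_apply, funext_iff, Fin.forall_fin_two]
  rfl

lemma finrank_orthPair {u v : Fin k → ℝ} (h : LinearIndependent ℝ ![u, v]) :
    Module.finrank ℝ (orthPair u v) + 2 = k := by
  have h1 := LinearMap.finrank_range_add_finrank_ker (Matrix.of ![u, v]).mulVecLin
  have h2 : (Matrix.of ![u, v]).rank = 2 := by
    simpa using LinearIndependent.rank_matrix (M := Matrix.of ![u, v]) h
  rw [Matrix.rank] at h2
  rw [h2, Module.finrank_fin_fun] at h1
  rw [orthPair]
  omega

lemma linearIndependent_snoc_one {s t : Fin k → ℝ} (h : s ≠ t) : LinearIndependent ℝ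
    ![(Fin.snoc s 1 : Fin (k + 1) → ℝ), (Fin.snoc t 1 : Fin (k + 1) → ℝ)] := by
  rw [LinearIndependent.pair_iff]
  intro a b hab
  have h1 : a * 1 + b * 1 = 0 := by
    have := congrArg lastCoord hab
    simpa [lastCoord] using this
  have h2 : a • s + b • t = 0 := by
    have h3 := congrArg projInit hab
    change a • projInit (Fin.snoc s 1 : Fin (k + 1) → ℝ)
      + b • projInit (Fin.snoc t 1 : Fin (k + 1) → ℝ) = 0 at h3
    rwa [projInit_snoc, projInit_snoc] at h3
  have hb : b = -a := by linarith
  rw [hb, neg_smul, ← sub_eq_add_neg, ← smul_sub, smul_eq_zero, sub_eq_zero,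
    or_iff_left h] at h2
  exact ⟨h2, by rw [hb, h2, neg_zero]⟩

lemma exists_eq_smul_of_forall_dotProduct {m w : Fin k → ℝ}
    (h : ∀ y, m ⬝ᵥ y = 0 → w ⬝ᵥ y = 0) : ∃ c : ℝ, w = c • m := by
  by_cases hm : m = 0
  · exact ⟨0, by simpa using dotProduct_self_eq_zero.1 (h w (by simp [hm]))⟩
  have hmm : m ⬝ᵥ m ≠ 0 := fun h0 => hm (dotProduct_self_eq_zero.1 h0)
  have h1 : m ⬝ᵥ (w - ((m ⬝ᵥ w) / (m ⬝ᵥ m)) • m) = 0 := by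
    rw [dotProduct_sub, dotProduct_smul, smul_eq_mul, div_mul_cancel₀ _ hmm, sub_self]
  refine ⟨(m ⬝ᵥ w) / (m ⬝ᵥ m), sub_eq_zero.1 (dotProduct_self_eq_zero.1 ?_)⟩
  nth_rw 1 [sub_dotProduct, smul_dotProduct, h1, h _ h1]
  simp

lemma exists_smul_add_mem_of_mem_intrinsicInterior {F : Set (Fin k → ℝ)} {p l : Fin k → ℝ}
    (hp : p ∈ intrinsicInterior ℝ F) (hl : l ∈ (affineSpan ℝ F).direction) :
    ∃ ε : ℝ, 0 < ε ∧ ε • l + p ∈ F := by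
  obtain ⟨q, hq, rfl⟩ := mem_intrinsicInterior.1 hp
  obtain ⟨r, hr, hball⟩ := Metric.mem_nhds_iff.1 (mem_interior_iff_mem_nhds.1 hq)
  have hε : 0 < r / (‖l‖ + 1) := by positivity
  refine ⟨r / (‖l‖ + 1), hε, ?_⟩
  have hmem : (r / (‖l‖ + 1)) • l + (q : Fin k → ℝ) ∈ affineSpan ℝ F :=
    AffineSubspace.vadd_mem_of_mem_direction (Submodule.smul_mem _ _ hl) q.2
  refine hball (show (⟨_, hmem⟩ : affineSpan ℝ F) ∈ _ from ?_)
  rw [Metric.mem_ball, Subtype.dist_eq, dist_eq_norm, add_sub_cancel_right, norm_smul,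
    Real.norm_of_nonneg hε.le, div_mul_eq_mul_div, div_lt_iff₀ (by positivity)]
  nlinarith [norm_nonneg l]

lemma mem_intrinsicInterior_of_ball {F : Set (Fin k → ℝ)} {p : Fin k → ℝ} (hp : p ∈ F) {r : ℝ}
    (hr : 0 < r) (h : ∀ x ∈ affineSpan ℝ F, dist x p ≤ r → x ∈ F) :
    p ∈ intrinsicInterior ℝ F := by
  refine mem_intrinsicInterior.2 ⟨⟨p, subset_affineSpan ℝ F hp⟩, ?_, rfl⟩
  refine mem_interior_iff_mem_nhds.2 (Metric.mem_nhds_iff.2 ⟨r, hr, fun x hx => ?_⟩)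
  exact h x x.2 (le_of_lt hx)

end LinearAlgebra

/-! ### From short tops to decompositions -/

section Forward

variable {k : ℕ}

lemma negE_eq_snoc : negE k = Fin.snoc (0 : Fin k → ℝ) (-1) := by
  funext i
  refine Fin.lastCases ?_ (fun j => ?_) i
  · simp [negE]
  · simp [negE, Fin.castSucc_ne_last]

lemma snoc_dotProduct_snoc (x y : Fin k → ℝ) (s t : ℝ) :
    (Fin.snoc x s : Fin (k + 1) → ℝ) ⬝ᵥ (Fin.snoc y t : Fin (k + 1) → ℝ) = x ⬝ᵥ y + s * t := by
  rw [dotProduct_eq_sum_projInit, projInit_snoc, projInit_snoc, lastCoord_snoc, lastCoord_snoc]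

lemma eq_snoc {x : Fin (k + 1) → ℝ} {y : Fin k → ℝ} {h : ℝ} (h1 : projInit x = y)
    (h2 : lastCoord x = h) : x = Fin.snoc y h := by
  rw [← h1, ← h2, snoc_projInit_lastCoord]

/-- The lattice points at height one spanning a short top together with its boundary. -/
lemma IsShortTop.exists_summit_finset {T : Set (Fin (k + 1) → ℝ)} (hT : IsShortTop T) :
    ∃ S : Finset (Fin k → ℝ), S.Nonempty ∧
      (∀ s ∈ S, IsLatticePt s ∧ (Fin.snoc s 1 : Fin (k + 1) → ℝ) ∈ T) ∧
      ∀ y ∈ polarDual (projInit '' (T ∩ {x | lastCoord x = 0})), ∀ h : ℝ,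
        (∀ s ∈ S, -1 ≤ s ⬝ᵥ y + h) → (Fin.snoc y h : Fin (k + 1) → ℝ) ∈ polarDual T := by
  obtain ⟨V, hV, hTV⟩ := hT.1.poly
  have hVT : ∀ v ∈ V, v ∈ T := fun v hv => by
    rw [hTV]
    exact subset_convexHull ℝ _ hv
  have hV01 : ∀ v ∈ V, lastCoord v = 0 ∨ lastCoord v = 1 := by
    intro v hv
    obtain ⟨n, hn⟩ := hV v hv (Fin.last k)
    have hn0 : (0 : ℝ) ≤ n := hn ▸ hT.1.halfspace v (hVT v hv)
    have hn0' : 0 ≤ n := by exact_mod_cast hn0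
    rcases hn0'.eq_or_lt with h | h
    · left
      rw [lastCoord, hn, ← h, Int.cast_zero]
    · right
      refine hT.2 v ⟨⟨hVT v hv, ?_⟩, hV v hv⟩
      change 1 ≤ v (Fin.last k)
      rw [hn]
      exact_mod_cast h
  refine ⟨(V.filter fun v => lastCoord v = 1).image projInit, ?_, ?_, ?_⟩
  · rw [Finset.image_nonempty, Finset.nonempty_iff_ne_empty]
    intro hempty
    obtain ⟨N, -, hTN⟩ := hT.1.facets
    obtain ⟨ε, hε, hmem⟩ := exists_smul_mem_polarDual N.finite_toSet.isBounded
      (Fin.snoc (0 : Fin k → ℝ) 1 : Fin (k + 1) → ℝ)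
    have hlast : lastCoord (ε • (Fin.snoc (0 : Fin k → ℝ) 1 : Fin (k + 1) → ℝ)) = ε := by
      simp [lastCoord]
    have hεT : ε • (Fin.snoc (0 : Fin k → ℝ) 1 : Fin (k + 1) → ℝ) ∈ T := by
      rw [hTN]
      exact ⟨by rw [Set.mem_ofPred_eq, hlast]; exact hε.le, Set.mem_iInter₂.2 hmem⟩
    rw [hTV] at hεT
    have h := dotProduct_ge_of_mem_convexHull
      (u := (Fin.snoc (0 : Fin k → ℝ) (-1) : Fin (k + 1) → ℝ)) (c := 0) (fun v hv => ?_) hεT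
    · rw [dotProduct_eq_sum_projInit, hlast] at h
      simp only [projInit_snoc, lastCoord_snoc, zero_dotProduct] at h
      linarith
    · rw [dotProduct_eq_sum_projInit]
      rcases hV01 v hv with h0 | h1
      · simp [h0]
      · have hv' : v ∈ V.filter fun v => lastCoord v = 1 := Finset.mem_filter.2 ⟨hv, h1⟩
        rw [hempty] at hv'
        exact absurd hv' (Finset.notMem_empty _)
  · intro s hs
    obtain ⟨v, hv, rfl⟩ := Finset.mem_image.1 hs
    rw [Finset.mem_filter] at hv
    refine ⟨(hV v hv.1).projInit, ?_⟩
    rw [← eq_snoc rfl hv.2]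
    exact hVT v hv.1
  · intro y hy h hS x hx
    change -1 ≤ x ⬝ᵥ _
    rw [hTV] at hx
    rw [dotProduct_comm]
    refine dotProduct_ge_of_mem_convexHull (fun v hv => ?_) hx
    rw [dotProduct_comm, dotProduct_eq_sum_projInit, projInit_snoc, lastCoord_snoc]
    rcases hV01 v hv with h0 | h1
    · rw [h0, zero_mul, add_zero]
      exact mem_polarDual.1 hy _ ⟨v, ⟨hVT v hv, h0⟩, rfl⟩
    · rw [h1, one_mul]
      exact hS _ (Finset.mem_image_of_mem _ (Finset.mem_filter.2 ⟨hv, h1⟩))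

lemma mem_direction_of_smul_add_mem {F : Set (Fin k → ℝ)} {p l : Fin k → ℝ} {ε : ℝ} (hε : ε ≠ 0)
    (hp : p ∈ F) (h : ε • l + p ∈ F) : l ∈ (affineSpan ℝ F).direction := by
  have h1 := AffineSubspace.vsub_mem_direction (subset_affineSpan ℝ F h) (subset_affineSpan ℝ F hp)
  rw [vsub_eq_sub, add_sub_cancel_right] at h1
  exact (Submodule.smul_mem_iff _ hε).1 h1

lemma le_finrank_add_one_of_dotProduct_ker_le {u : Fin k → ℝ} {L : Submodule ℝ (Fin k → ℝ)}
    (h : ∀ x, u ⬝ᵥ x = 0 → x ∈ L) : k ≤ Module.finrank ℝ L + 1 := by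
  have hle : LinearMap.ker (dotProductBilin ℝ ℝ u) ≤ L := fun x hx => h x hx
  have h1 := LinearMap.finrank_range_add_finrank_ker (dotProductBilin ℝ ℝ u)
  have h2 := Submodule.finrank_le (LinearMap.range (dotProductBilin ℝ ℝ u))
  rw [Module.finrank_self] at h2
  rw [Module.finrank_fin_fun] at h1
  have h3 := Submodule.finrank_mono hle
  omega

/-- If the dual of a short top has `(0,0,0,-1)` in the interior of a two-face, then the summit
spans a segment. -/
lemma exists_segment_of_isFace {T : Set (Fin (3 + 1) → ℝ)} (hT : IsShortTop T)
    (hbdd : Bornology.IsBounded (projInit '' (T ∩ {x | lastCoord x = 0})))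
    {F : Set (Fin (3 + 1) → ℝ)} (hF : IsFace (polarDual T) F 2)
    (hneg : negE 3 ∈ intrinsicInterior ℝ F) :
    ∃ (S : Finset (Fin 3 → ℝ)) (s₀ s₁ : Fin 3 → ℝ), s₀ ∈ S ∧ s₁ ∈ S ∧ s₀ ≠ s₁ ∧
      (∀ s ∈ S, ∃ c : ℝ, s - s₀ = c • (s₁ - s₀)) ∧
      (∀ s ∈ S, IsLatticePt s ∧ (Fin.snoc s 1 : Fin (3 + 1) → ℝ) ∈ T) ∧
      ∀ y ∈ polarDual (projInit '' (T ∩ {x | lastCoord x = 0})), ∀ h : ℝ,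
        (∀ s ∈ S, -1 ≤ s ⬝ᵥ y + h) → (Fin.snoc y h : Fin (3 + 1) → ℝ) ∈ polarDual T := by
  obtain ⟨S, ⟨s₀, hs₀⟩, hS, hdual⟩ := hT.exists_summit_finset
  obtain ⟨n, c, hn0, hnc, hFeq, hdim⟩ := hF
  replace hnc : ∀ x ∈ polarDual T, c ≤ n ⬝ᵥ x := hnc
  have hFmem : ∀ x, x ∈ F ↔ x ∈ polarDual T ∧ n ⬝ᵥ x = c := fun x => by rw [hFeq]; rfl
  have hnegF := intrinsicInterior_subset hneg
  set L := (affineSpan ℝ F).direction with hL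
  have hLS : ∀ l ∈ L, ∀ s ∈ S, (Fin.snoc s 1 : Fin (3 + 1) → ℝ) ⬝ᵥ l = 0 := by
    have hle : ∀ l ∈ L, ∀ s ∈ S, 0 ≤ (Fin.snoc s 1 : Fin (3 + 1) → ℝ) ⬝ᵥ l := by
      intro l hl s hs
      obtain ⟨ε, hε, hmem⟩ := exists_smul_add_mem_of_mem_intrinsicInterior hneg hl
      have h := mem_polarDual.1 ((hFmem _).1 hmem).1 _ (hS s hs).2
      rw [dotProduct_add, negE_eq_snoc, snoc_dotProduct_snoc, dotProduct_zero, dotProduct_smul,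
        smul_eq_mul] at h
      exact nonneg_of_mul_nonneg_right (by linarith) hε
    intro l hl s hs
    refine le_antisymm ?_ (hle l hl s hs)
    have h := hle (-l) (neg_mem hl) s hs
    rw [dotProduct_neg] at h
    linarith
  have hex : ∃ s₁ ∈ S, s₀ ≠ s₁ := by
    by_contra! hall
    have hgraph : ∀ y ∈ polarDual (projInit '' (T ∩ {x | lastCoord x = 0})),
        (Fin.snoc y (-1 - s₀ ⬝ᵥ y) : Fin (3 + 1) → ℝ) ∈ polarDual T := fun y hy =>
      hdual y hy _ fun s hs => by rw [← hall s hs]; linarith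
    have hc : c = -lastCoord n := by
      rw [← ((hFmem _).1 hnegF).2, negE_eq_snoc, dotProduct_eq_sum_projInit]
      simp
    have hn' : projInit n = lastCoord n • s₀ := by
      refine sub_eq_zero.1 (eq_zero_of_forall_mem_polarDual hbdd fun y hy => ?_)
      have h := hnc _ (hgraph y hy)
      rw [dotProduct_eq_sum_projInit, projInit_snoc, lastCoord_snoc] at h
      rw [sub_dotProduct, smul_dotProduct, smul_eq_mul]
      linarith
    have hmemF : ∀ y ∈ polarDual (projInit '' (T ∩ {x | lastCoord x = 0})),
        (Fin.snoc y (-1 - s₀ ⬝ᵥ y) : Fin (3 + 1) → ℝ) ∈ F := fun y hy => by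
      refine (hFmem _).2 ⟨hgraph y hy, ?_⟩
      rw [dotProduct_eq_sum_projInit, projInit_snoc, lastCoord_snoc, hn', smul_dotProduct,
        smul_eq_mul]
      linarith
    have hker : ∀ l, (Fin.snoc s₀ 1 : Fin (3 + 1) → ℝ) ⬝ᵥ l = 0 → l ∈ L := by
      intro l hl
      obtain ⟨ε, hε, hmem⟩ := exists_smul_mem_polarDual hbdd (projInit l)
      refine mem_direction_of_smul_add_mem hε.ne' hnegF ?_
      convert hmemF _ hmem using 1
      rw [dotProduct_eq_sum_projInit, projInit_snoc, lastCoord_snoc, one_mul] at hl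
      refine eq_snoc ?_ ?_
      · change ε • projInit l + projInit (negE 3) = _
        rw [negE_eq_snoc, projInit_snoc, add_zero]
      · change ε * lastCoord l + lastCoord (negE 3) = _
        rw [negE_eq_snoc, lastCoord_snoc, dotProduct_smul, smul_eq_mul]
        linear_combination ε * hl
    have := le_finrank_add_one_of_dotProduct_ker_le hker
    omega
  obtain ⟨s₁, hs₁, hne⟩ := hex
  refine ⟨S, s₀, s₁, hs₀, hs₁, hne, fun s hs => ?_, hS, hdual⟩
  have hLeq : L = orthPair (Fin.snoc s₀ 1 : Fin (3 + 1) → ℝ) (Fin.snoc s₁ 1) := by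
    refine Submodule.eq_of_le_of_finrank_eq
      (fun l hl => mem_orthPair.2 ⟨hLS l hl _ hs₀, hLS l hl _ hs₁⟩) ?_
    have := finrank_orthPair (linearIndependent_snoc_one hne)
    omega
  refine exists_eq_smul_of_forall_dotProduct fun y hy => ?_
  rw [sub_dotProduct] at hy
  have hmem : (Fin.snoc y (-(s₀ ⬝ᵥ y)) : Fin (3 + 1) → ℝ) ∈ L := by
    rw [hLeq, mem_orthPair, snoc_dotProduct_snoc, snoc_dotProduct_snoc]
    constructor <;> linarith
  have h := hLS _ hmem s hs
  rw [snoc_dotProduct_snoc] at h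
  rw [sub_dotProduct]
  linarith

/-- The cut of the dual of the boundary of a short top induced by a two-face of the dual. -/
lemma exists_isLatticePolytope_halves {T : Set (Fin (3 + 1) → ℝ)} (hT : IsShortTop T)
    (hbdd : Bornology.IsBounded (projInit '' (T ∩ {x | lastCoord x = 0})))
    {F : Set (Fin (3 + 1) → ℝ)} (hF : IsFace (polarDual T) F 2)
    (hneg : negE 3 ∈ intrinsicInterior ℝ F) :
    ∃ m : Fin 3 → ℤ, m ≠ 0 ∧
      IsLatticePolytope (polarDual (projInit '' (T ∩ {x | lastCoord x = 0})) ∩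
        {x | 0 ≤ ∑ i, (m i : ℝ) * x i}) ∧
      IsLatticePolytope (polarDual (projInit '' (T ∩ {x | lastCoord x = 0})) ∩
        {x | ∑ i, (m i : ℝ) * x i ≤ 0}) := by
  obtain ⟨S, s₀, s₁, hs₀, hs₁, hne, hline, hS, hdual⟩ := exists_segment_of_isFace hT hbdd hF hneg
  set u := s₁ - s₀ with hu
  have huu : 0 < u ⬝ᵥ u := lt_of_le_of_ne (Finset.sum_nonneg fun i _ => mul_self_nonneg _)
    fun h => hne (sub_eq_zero.1 (dotProduct_self_eq_zero.1 h.symm)).symm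
  obtain ⟨a, haS, ha⟩ := S.exists_min_image (fun s => u ⬝ᵥ s) ⟨s₀, hs₀⟩
  obtain ⟨b, hbS, hb⟩ := S.exists_max_image (fun s => u ⬝ᵥ s) ⟨s₀, hs₀⟩
  have hdiff : ∀ s ∈ S, ∀ t ∈ S, ∃ r : ℝ, s - t = r • u := by
    intro s hs t ht
    obtain ⟨c, hc⟩ := hline s hs
    obtain ⟨d, hd⟩ := hline t ht
    exact ⟨c - d, by rw [sub_smul, ← hc, ← hd]; abel⟩
  have hdiff_nonneg : ∀ s ∈ S, ∀ t ∈ S, u ⬝ᵥ t ≤ u ⬝ᵥ s → ∃ r : ℝ, 0 ≤ r ∧ s - t = r • u := by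
    intro s hs t ht hst
    obtain ⟨r, hr⟩ := hdiff s hs t ht
    refine ⟨r, ?_, hr⟩
    have h := congrArg (fun x => u ⬝ᵥ x) hr
    simp only [dotProduct_sub, dotProduct_smul, smul_eq_mul] at h
    exact nonneg_of_mul_nonneg_left (by linarith) huu
  have hablt : u ⬝ᵥ a < u ⬝ᵥ b := by
    have h1 := ha s₀ hs₀
    have h2 := hb s₁ hs₁
    have h3 : u ⬝ᵥ u = u ⬝ᵥ s₁ - u ⬝ᵥ s₀ := by rw [← dotProduct_sub]
    linarith
  obtain ⟨r, hr0, hr⟩ := hdiff_nonneg b hbS a haS hablt.le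
  have hrpos : 0 < r := by
    refine lt_of_le_of_ne hr0 fun h => ?_
    rw [← h, zero_smul, sub_eq_zero] at hr
    rw [hr] at hablt
    exact lt_irrefl _ hablt
  have hA := hT.1.isLatticePolytope_half (hS a haS).2 (hS b hbS).2 fun y hy hy0 =>
    hdual y hy _ fun s hs => by
      obtain ⟨t, ht, hst⟩ := hdiff_nonneg s hs a haS (ha s hs)
      rw [hr, smul_dotProduct, smul_eq_mul, mul_nonneg_iff_of_pos_left hrpos] at hy0
      have h := congrArg (fun x => x ⬝ᵥ y) hst
      simp only [sub_dotProduct, smul_dotProduct, smul_eq_mul] at h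
      linarith [mul_nonneg ht hy0]
  have hB := hT.1.isLatticePolytope_half (hS b hbS).2 (hS a haS).2 fun y hy hy0 =>
    hdual y hy _ fun s hs => by
      obtain ⟨t, ht, hst⟩ := hdiff_nonneg b hbS s hs (hb s hs)
      rw [← neg_sub, hr, neg_dotProduct, smul_dotProduct, smul_eq_mul, ← mul_neg,
        mul_nonneg_iff_of_pos_left hrpos] at hy0
      have h := congrArg (fun x => x ⬝ᵥ y) hst
      simp only [sub_dotProduct, smul_dotProduct, smul_eq_mul] at h
      linarith [mul_nonneg ht hy0]
  obtain ⟨a', rfl⟩ := (hS a haS).1.exists_intCast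
  obtain ⟨b', rfl⟩ := (hS b hbS).1.exists_intCast
  have hm : (fun i => (b' i : ℝ)) - (fun i => (a' i : ℝ)) = fun i => ((b' - a') i : ℝ) := by
    funext i
    simp
  refine ⟨b' - a', fun h => hablt.ne ?_, ?_, ?_⟩
  · rw [sub_eq_zero.1 h]
  · rw [hm] at hA
    exact hA
  · rw [← neg_sub, hm] at hB
    convert hB using 4 with x
    rw [neg_dotProduct, Left.nonneg_neg_iff]
    rfl

end Forward

/-! ### From decompositions to short tops -/

section Backward

/-- The polytope spanned by `Δ` at height `0` and by `0` and `u` at height `1`. -/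
def segmentTop {k : ℕ} (Δ : Set (Fin k → ℝ)) (u : Fin k → ℝ) : Set (Fin (k + 1) → ℝ) :=
  convexHull ℝ ((fun v => Fin.snoc v 0) '' Δ ∪ {Fin.snoc 0 1, Fin.snoc u 1})

variable {k : ℕ} {Δ : Set (Fin k → ℝ)} {u : Fin k → ℝ}

lemma mem_polarDual_segmentTop {p : Fin (k + 1) → ℝ} : p ∈ polarDual (segmentTop Δ u) ↔
    projInit p ∈ polarDual Δ ∧ -1 ≤ lastCoord p ∧ -1 ≤ u ⬝ᵥ projInit p + lastCoord p := by
  rw [segmentTop, polarDual_convexHull, mem_polarDual, mem_polarDual]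
  simp only [dotProduct_eq_sum_projInit _ p]
  constructor
  · intro h
    refine ⟨fun x hx => ?_, ?_, ?_⟩
    · simpa using h _ (Or.inl ⟨x, hx, rfl⟩)
    · simpa using h _ (Or.inr (Or.inl rfl))
    · simpa using h _ (Or.inr (Or.inr rfl))
  · rintro ⟨h1, h2, h3⟩ _ (⟨x, hx, rfl⟩ | rfl | rfl)
    · simpa using h1 x hx
    · simpa using h2
    · simpa using h3

lemma isLatticePolytope_segmentTop (hΔ : IsLatticePolytope Δ) (hu : IsLatticePt u) :
    IsLatticePolytope (segmentTop Δ u) := by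
  obtain ⟨V, hV, rfl⟩ := hΔ
  refine ⟨V.image (fun v => Fin.snoc v 0) ∪ {Fin.snoc 0 1, Fin.snoc u 1}, ?_, ?_⟩
  · intro v hv
    simp only [Finset.mem_union, Finset.mem_image, Finset.mem_insert, Finset.mem_singleton] at hv
    rcases hv with ⟨w, hw, rfl⟩ | rfl | rfl
    · exact (hV w hw).snoc ⟨0, by simp⟩
    · exact IsLatticePt.zero.snoc ⟨1, by simp⟩
    · exact hu.snoc ⟨1, by simp⟩
  · let f : (Fin k → ℝ) →ₗ[ℝ] (Fin (k + 1) → ℝ) :=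
      { toFun := fun v => Fin.snoc v 0
        map_add' := fun x y => by
          refine (eq_snoc ?_ ?_).symm
          · change projInit (Fin.snoc x 0 : Fin (k + 1) → ℝ) +
              projInit (Fin.snoc y 0 : Fin (k + 1) → ℝ) = _
            simp
          · simp [lastCoord]
        map_smul' := fun c x => by
          refine (eq_snoc ?_ ?_).symm
          · change c • projInit (Fin.snoc x 0 : Fin (k + 1) → ℝ) = _
            simp
          · simp [lastCoord] }
    have himg : (fun v => (Fin.snoc v 0 : Fin (k + 1) → ℝ)) '' convexHull ℝ (V : Set (Fin k → ℝ))
        = convexHull ℝ ((fun v => Fin.snoc v 0) '' (V : Set (Fin k → ℝ))) :=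
      f.image_convexHull _
    rw [segmentTop, himg, convexHull_convexHull_union_left]
    simp

lemma polarDual_polarDual_segmentTop (hΔ : IsLatticePolytope Δ) (h0 : (0 : Fin k → ℝ) ∈ Δ)
    (hu : IsLatticePt u) : polarDual (polarDual (segmentTop Δ u)) = segmentTop Δ u := by
  have h := isLatticePolytope_segmentTop hΔ hu
  refine polarDual_polarDual h.convex h.isCompact.isClosed (subset_convexHull ℝ _
    (Or.inl ⟨0, h0, ?_⟩))
  exact (eq_snoc (x := 0) (y := 0) (h := 0) rfl rfl).symm

lemma projInit_image_segmentTop (hΔ : IsLatticePolytope Δ) (h0 : (0 : Fin k → ℝ) ∈ Δ) :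
    projInit '' (segmentTop Δ u ∩ {x | lastCoord x = 0}) = Δ := by
  apply Set.Subset.antisymm
  · rintro _ ⟨x, ⟨hx, hx0⟩, rfl⟩
    rw [← polarDual_polarDual hΔ.convex hΔ.isCompact.isClosed h0]
    intro y hy
    have hp : (Fin.snoc y (max (-1) (-1 - u ⬝ᵥ y)) : Fin (k + 1) → ℝ)
        ∈ polarDual (segmentTop Δ u) := by
      rw [mem_polarDual_segmentTop, projInit_snoc, lastCoord_snoc]
      exact ⟨hy, le_max_left _ _, by linarith [le_max_right (-1) (-1 - u ⬝ᵥ y)]⟩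
    have h := mem_polarDual.1 hp x hx
    rw [dotProduct_eq_sum_projInit, show lastCoord x = 0 from hx0, projInit_snoc, zero_mul,
      add_zero, dotProduct_comm] at h
    exact h
  · exact fun x hx => ⟨_, ⟨subset_convexHull ℝ _ (Or.inl ⟨x, hx, rfl⟩), lastCoord_snoc x 0⟩,
      projInit_snoc x 0⟩

/-- If both halves of the dual of `Δ` cut out by `u` are lattice polytopes, then `segmentTop Δ u`
is a short top. -/
lemma isShortTop_segmentTop (hΔ : IsReflexive Δ) (hu : IsLatticePt u)
    (hA : IsLatticePolytope (polarDual Δ ∩ {y | 0 ≤ u ⬝ᵥ y}))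
    (hB : IsLatticePolytope (polarDual Δ ∩ {y | u ⬝ᵥ y ≤ 0})) :
    IsShortTop (segmentTop Δ u) := by
  have hhalf : ∀ x ∈ segmentTop Δ u, 0 ≤ lastCoord x := by
    intro x hx
    have h := dotProduct_ge_of_mem_convexHull (u := (Fin.snoc 0 1 : Fin (k + 1) → ℝ)) (c := 0)
      (fun v hv => ?_) hx
    · simpa [dotProduct_eq_sum_projInit] using h
    · rcases hv with ⟨w, hw, rfl⟩ | rfl | rfl <;> simp [snoc_dotProduct_snoc]
  refine ⟨⟨isLatticePolytope_segmentTop hΔ.1 hu, hhalf, ?_, ?_⟩, ?_⟩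
  · obtain ⟨VA, hVA, hAeq⟩ := hA
    obtain ⟨VB, hVB, hBeq⟩ := hB
    have hVA' : ∀ v ∈ VA, v ∈ polarDual Δ ∧ 0 ≤ u ⬝ᵥ v := fun v hv => by
      have : v ∈ polarDual Δ ∩ {y | 0 ≤ u ⬝ᵥ y} := hAeq ▸ subset_convexHull ℝ _ hv
      exact this
    have hVB' : ∀ v ∈ VB, v ∈ polarDual Δ ∧ u ⬝ᵥ v ≤ 0 := fun v hv => by
      have : v ∈ polarDual Δ ∩ {y | u ⬝ᵥ y ≤ 0} := hBeq ▸ subset_convexHull ℝ _ hv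
      exact this
    refine ⟨VA.image (fun v => Fin.snoc v (-1)) ∪ VB.image (fun v => Fin.snoc v (-1 - u ⬝ᵥ v)),
      fun n hn => ?_, ?_⟩
    · rcases Finset.mem_union.1 hn with h | h <;> obtain ⟨v, hv, rfl⟩ := Finset.mem_image.1 h
      · exact (hVA v hv).snoc ⟨-1, by simp⟩
      · obtain ⟨z, hz⟩ := hu.dotProduct (hVB v hv)
        exact (hVB v hv).snoc ⟨-1 - z, by simp [hz]⟩
    · apply Set.Subset.antisymm
      · intro x hx
        refine ⟨hhalf x hx, Set.mem_iInter₂.2 fun n hn => ?_⟩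
        change -1 ≤ n ⬝ᵥ x
        rw [dotProduct_comm]
        refine mem_polarDual.1 (mem_polarDual_segmentTop.2 ?_) x hx
        rcases Finset.mem_union.1 hn with h | h <;> obtain ⟨v, hv, rfl⟩ := Finset.mem_image.1 h
        · rw [projInit_snoc, lastCoord_snoc]
          exact ⟨(hVA' v hv).1, le_rfl, by linarith [(hVA' v hv).2]⟩
        · rw [projInit_snoc, lastCoord_snoc]
          exact ⟨(hVB' v hv).1, by linarith [(hVB' v hv).2], by linarith⟩
      · rintro x ⟨hx0, hx⟩
        replace hx0 : 0 ≤ lastCoord x := hx0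
        replace hx := Set.mem_iInter₂.1 hx
        have hxA : ∀ y ∈ polarDual Δ, 0 ≤ u ⬝ᵥ y → -1 + lastCoord x ≤ projInit x ⬝ᵥ y := by
          intro y hy hy0
          have hyA : y ∈ polarDual Δ ∩ {y | 0 ≤ u ⬝ᵥ y} := ⟨hy, hy0⟩
          rw [hAeq] at hyA
          refine dotProduct_ge_of_mem_convexHull (fun v hv => ?_) hyA
          have h : -1 ≤ (Fin.snoc v (-1) : Fin (k + 1) → ℝ) ⬝ᵥ x :=
            hx _ (Finset.mem_union_left _ (Finset.mem_image_of_mem _ hv))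
          rw [dotProduct_eq_sum_projInit, projInit_snoc, lastCoord_snoc, dotProduct_comm] at h
          linarith
        have hxB : ∀ y ∈ polarDual Δ, u ⬝ᵥ y ≤ 0 →
            -1 + lastCoord x ≤ (projInit x - lastCoord x • u) ⬝ᵥ y := by
          intro y hy hy0
          have hyB : y ∈ polarDual Δ ∩ {y | u ⬝ᵥ y ≤ 0} := ⟨hy, hy0⟩
          rw [hBeq] at hyB
          refine dotProduct_ge_of_mem_convexHull (fun v hv => ?_) hyB
          have h : -1 ≤ (Fin.snoc v (-1 - u ⬝ᵥ v) : Fin (k + 1) → ℝ) ⬝ᵥ x :=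
            hx _ (Finset.mem_union_right _ (Finset.mem_image.2 ⟨v, hv, rfl⟩))
          rw [dotProduct_eq_sum_projInit, projInit_snoc, lastCoord_snoc, dotProduct_comm] at h
          rw [sub_dotProduct, smul_dotProduct, smul_eq_mul]
          linarith
        rw [← polarDual_polarDual_segmentTop hΔ.1 hΔ.2.1 hu]
        intro p hp
        obtain ⟨hp1, hp2, hp3⟩ := mem_polarDual_segmentTop.1 hp
        change -1 ≤ p ⬝ᵥ x
        rw [dotProduct_eq_sum_projInit, dotProduct_comm]
        rcases le_total 0 (u ⬝ᵥ projInit p) with h | h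
        · have h' := hxA _ hp1 h
          have h'' := mul_nonneg hx0 (neg_le_iff_add_nonneg.1 hp2)
          rw [mul_add, mul_one] at h''
          linarith
        · have h' := hxB _ hp1 h
          rw [sub_dotProduct, smul_dotProduct, smul_eq_mul] at h'
          have h'' := mul_nonneg hx0 (neg_le_iff_add_nonneg.1 hp3)
          rw [mul_add, mul_add, mul_one] at h''
          linarith
  · rw [projInit_image_segmentTop hΔ.1 hΔ.2.1]
    exact hΔ
  · rintro x ⟨⟨hx, hx1⟩, -⟩
    refine le_antisymm ?_ hx1
    have hp : (Fin.snoc 0 (-1) : Fin (k + 1) → ℝ) ∈ polarDual (segmentTop Δ u) := by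
      rw [mem_polarDual_segmentTop, projInit_snoc, lastCoord_snoc]
      exact ⟨zero_mem_polarDual _, le_rfl, by simp⟩
    have h := mem_polarDual.1 hp x hx
    rw [dotProduct_eq_sum_projInit, projInit_snoc, lastCoord_snoc, dotProduct_zero] at h
    linarith

/-- The dual of `segmentTop Δ u` has `(0, …, 0, -1)` in the interior of a face of codimension
two. -/
lemma exists_isFace_segmentTop {d : ℕ} (hd : d + 1 = k) (hΔ : Bornology.IsBounded Δ)
    (hu : u ≠ 0) :
    ∃ F, IsFace (polarDual (segmentTop Δ u)) F d ∧ negE k ∈ intrinsicInterior ℝ F := by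
  set F := {p ∈ polarDual (segmentTop Δ u) |
    (Fin.snoc u 2 : Fin (k + 1) → ℝ) ⬝ᵥ p = -2} with hF
  have hFmem : ∀ p, p ∈ F ↔ projInit p ∈ polarDual Δ ∧ lastCoord p = -1 ∧
      u ⬝ᵥ projInit p = 0 := by
    intro p
    rw [hF, Set.mem_ofPred_eq, mem_polarDual_segmentTop, dotProduct_eq_sum_projInit,
      projInit_snoc, lastCoord_snoc]
    constructor
    · rintro ⟨⟨h1, h2, h3⟩, h4⟩
      exact ⟨h1, by linarith, by linarith⟩
    · rintro ⟨h1, h2, h3⟩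
      exact ⟨⟨h1, by linarith, by linarith⟩, by linarith⟩
  have hneg1 : projInit (negE k) = 0 := by rw [negE_eq_snoc, projInit_snoc]
  have hneg2 : lastCoord (negE k) = -1 := by rw [negE_eq_snoc, lastCoord_snoc]
  have hnegF : negE k ∈ F :=
    (hFmem _).2 ⟨hneg1 ▸ zero_mem_polarDual _, hneg2, by rw [hneg1, dotProduct_zero]⟩
  have hmemD : ∀ x, x ∈ orthPair (Fin.snoc 0 1 : Fin (k + 1) → ℝ) (Fin.snoc u 1) ↔
      lastCoord x = 0 ∧ u ⬝ᵥ projInit x = 0 := by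
    intro x
    rw [mem_orthPair, dotProduct_eq_sum_projInit, dotProduct_eq_sum_projInit, projInit_snoc,
      projInit_snoc, lastCoord_snoc, lastCoord_snoc, zero_dotProduct, zero_add, one_mul]
    exact and_congr_right fun h => by rw [h, add_zero]
  have hdir : (affineSpan ℝ F).direction
      = orthPair (Fin.snoc 0 1 : Fin (k + 1) → ℝ) (Fin.snoc u 1) := by
    apply le_antisymm
    · rw [direction_affineSpan, vectorSpan_def, Submodule.span_le]
      rintro _ ⟨x, hx, y, hy, rfl⟩
      rw [hFmem] at hx hy
      refine (hmemD _).2 ⟨?_, ?_⟩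
      · change lastCoord x - lastCoord y = 0
        rw [hx.2.1, hy.2.1, sub_self]
      · change u ⬝ᵥ (projInit x - projInit y) = 0
        rw [dotProduct_sub, hx.2.2, hy.2.2, sub_self]
    · intro l hl
      rw [hmemD] at hl
      obtain ⟨ε, hε, hmem⟩ := exists_smul_mem_polarDual hΔ (projInit l)
      refine mem_direction_of_smul_add_mem hε.ne' hnegF ((hFmem _).2 ?_)
      have h1 : projInit (ε • l + negE k) = ε • projInit l := by
        change ε • projInit l + projInit (negE k) = _
        rw [hneg1, add_zero]
      have h2 : lastCoord (ε • l + negE k) = ε * lastCoord l + lastCoord (negE k) := rfl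
      rw [h1, h2, hneg2, hl.1, dotProduct_smul, hl.2]
      exact ⟨hmem, by ring, smul_zero _⟩
  refine ⟨F, ⟨Fin.snoc u 2, -2, fun h => ?_, fun x hx => ?_, rfl, ?_⟩, ?_⟩
  · have h' := congrArg lastCoord h
    rw [lastCoord_snoc] at h'
    exact two_ne_zero h'
  · obtain ⟨-, h2, h3⟩ := mem_polarDual_segmentTop.1 hx
    change -2 ≤ (Fin.snoc u 2 : Fin (k + 1) → ℝ) ⬝ᵥ x
    rw [dotProduct_eq_sum_projInit, projInit_snoc, lastCoord_snoc]
    linarith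
  · rw [hdir]
    have := finrank_orthPair (linearIndependent_snoc_one hu.symm)
    omega
  · obtain ⟨r, hr, hball⟩ := exists_pos_forall_norm_le_mem_polarDual hΔ
    refine mem_intrinsicInterior_of_ball hnegF hr fun x hx hxr => ?_
    have hl := AffineSubspace.vsub_mem_direction hx (subset_affineSpan ℝ F hnegF)
    rw [hdir, hmemD] at hl
    have h1 : projInit (x - negE k) = projInit x := by
      change projInit x - projInit (negE k) = _
      rw [hneg1, sub_zero]
    have h2 : lastCoord x - lastCoord (negE k) = 0 := hl.1
    rw [vsub_eq_sub, h1] at hl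
    refine (hFmem x).2 ⟨hball _ ?_, by linarith, hl.2⟩
    rw [dist_eq_norm] at hxr
    rw [← h1, pi_norm_le_iff_of_nonneg hr.le]
    exact fun i => (norm_le_pi_norm (x - negE k) i.castSucc).trans hxr

end Backward

/-- A three-dimensional reflexive polytope `Δ` is the reflexive boundary of
a four-dimensional short top whose dual has `(0,0,0,-1)` in the interior of a two-face
iff `Δ°` decomposes as two three-dimensional tops glued along a common two-dimensional
reflexive polygon through the origin. -/
theorem stmt12 (Δ : Set (Fin 3 → ℝ)) (hΔ : IsReflexive Δ) :
    (∃ T : Set (Fin (3+1) → ℝ), IsShortTop T ∧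
        projInit '' (T ∩ {x | lastCoord x = 0}) = Δ ∧
        ∃ F, IsFace (polarDual T) F 2 ∧ negE 3 ∈ intrinsicInterior ℝ F)
    ↔ (∃ m : Fin 3 → ℤ, m ≠ 0 ∧
        (∃ (φ : (Fin 3 → ℝ) → (Fin 3 → ℝ)) (Q : Set (Fin 2 → ℝ)),
          UnimodularMap φ ∧ IsReflexive Q ∧
          φ '' (polarDual Δ ∩ {x | ∑ i, (m i : ℝ) * x i = 0})
            = (fun v => (Fin.snoc v 0 : Fin (2+1) → ℝ)) '' Q) ∧
        (∃ φA : (Fin 3 → ℝ) → (Fin 3 → ℝ), UnimodularMap φA ∧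
          IsTopPoly (k := 2) (φA '' (polarDual Δ ∩ {x | 0 ≤ ∑ i, (m i : ℝ) * x i}))) ∧
        (∃ φB : (Fin 3 → ℝ) → (Fin 3 → ℝ), UnimodularMap φB ∧
          IsTopPoly (k := 2) (φB '' (polarDual Δ ∩ {x | ∑ i, (m i : ℝ) * x i ≤ 0})))) := by
  constructor
  · rintro ⟨T, hT, rfl, F, hF, hneg⟩
    obtain ⟨m, hm, hA, hB⟩ :=
      exists_isLatticePolytope_halves hT hΔ.1.isCompact.isBounded hF hneg
    have hset : {x : Fin 3 → ℝ | ∑ i, (m i : ℝ) * x i ≤ 0}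
        = {x | 0 ≤ ∑ i, (((-m) i : ℤ) : ℝ) * x i} := by
      ext x
      simp
    rw [hset] at hB
    obtain ⟨φA, hφA, hφA0, hφAtop⟩ := exists_isTopPoly_half hΔ.1 hm hA
    obtain ⟨φB, hφB, -, hφBtop⟩ := exists_isTopPoly_half hΔ.1 (neg_ne_zero.2 hm) hB
    refine ⟨m, hm, ⟨φA, _, hφA, hφAtop.reflexive_boundary, ?_⟩, ⟨φA, hφA, hφAtop⟩,
      ⟨φB, hφB, hset ▸ hφBtop⟩⟩
    rw [← eq_image_snoc_image_projInit fun x hx => hx.2]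
    apply Set.Subset.antisymm
    · rintro _ ⟨x, ⟨hx, hx0⟩, rfl⟩
      exact ⟨⟨x, ⟨hx, le_of_eq (Eq.symm hx0)⟩, rfl⟩, (hφA0 x).2 hx0⟩
    · rintro _ ⟨⟨x, ⟨hx, -⟩, rfl⟩, hx0⟩
      exact ⟨x, ⟨hx, (hφA0 x).1 hx0⟩, rfl⟩
  · rintro ⟨m, hm, -, ⟨φA, hφA, hA⟩, ⟨φB, hφB, hB⟩⟩
    have hu : IsLatticePt fun i => (m i : ℝ) := IsLatticePt.intCast m
    refine ⟨segmentTop Δ fun i => (m i : ℝ), isShortTop_segmentTop hΔ hu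
      (hφA.isLatticePolytope_of_image hA.poly) (hφB.isLatticePolytope_of_image hB.poly),
      projInit_image_segmentTop hΔ.1 hΔ.2.1,
      exists_isFace_segmentTop rfl hΔ.1.isCompact.isBounded fun h => hm (funext fun i => ?_)⟩
    simpa using congrFun h i

end SemistableTops
end
end

section
/- The standard octahedron Δ° with vertices ±e_1, ±e_2, ±e_3 admits, up to lattice isomorphism, a unique lattice point triangulation in which every three-dimensional simplex contains an edge through the origin between two antipodal vertices: the triangulation into four simplices all containing the segment from (1,0,0) to (-1,0,0). -/
open Finset Matrix Pointwise
open scoped Classical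

noncomputable section

namespace SemistableTops

/-- The vertices `±e₁, ±e₂, ±e₃` of the standard octahedron. -/
def octaVerts : Finset (Fin 3 → ℝ) :=
  {![1,0,0], ![-1,0,0], ![0,1,0], ![0,-1,0], ![0,0,1], ![0,0,-1]}

/-- The standard octahedron in `ℝ³`. -/
def octa : Set (Fin 3 → ℝ) := convexHull ℝ (octaVerts : Set (Fin 3 → ℝ))

/-- A lattice point triangulation of a solid three-dimensional lattice polytope `P`. -/
def IsSolidLatticeTriangulation (P : Set (Fin 3 → ℝ))
    (𝒯 : Finset (Finset (Fin 3 → ℝ))) : Prop :=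
  (∀ σ ∈ 𝒯, (↑σ : Set (Fin 3 → ℝ)) ⊆ latticePts P ∧ σ.card = 4 ∧
      AffineIndependent ℝ (fun p : (σ : Set (Fin 3 → ℝ)) => (p : Fin 3 → ℝ))) ∧
  (⋃ σ ∈ 𝒯, convexHull ℝ (σ : Set (Fin 3 → ℝ))) = P ∧
  ∀ σ ∈ 𝒯, ∀ τ ∈ 𝒯, convexHull ℝ (σ : Set (Fin 3 → ℝ)) ∩ convexHull ℝ (τ : Set (Fin 3 → ℝ))
      = convexHull ℝ ((σ ∩ τ : Finset (Fin 3 → ℝ)) : Set (Fin 3 → ℝ))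

/-- Every simplex of `𝒯` contains an edge through the origin between two antipodal
vertices of the octahedron. -/
def HasAntipodalEdge (𝒯 : Finset (Finset (Fin 3 → ℝ))) : Prop :=
  ∃ u ∈ octaVerts, ∀ σ ∈ 𝒯, segment ℝ u (-u) ⊆ convexHull ℝ (σ : Set (Fin 3 → ℝ))

/-- The triangulation of the octahedron into four simplices all containing the segment
from `(1,0,0)` to `(-1,0,0)`. -/
def octaTri : Finset (Finset (Fin 3 → ℝ)) :=
  { {![1,0,0], ![-1,0,0], ![0,1,0], ![0,0,1]},
    {![1,0,0], ![-1,0,0], ![0,0,1], ![0,-1,0]},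
    {![1,0,0], ![-1,0,0], ![0,-1,0], ![0,0,-1]},
    {![1,0,0], ![-1,0,0], ![0,0,-1], ![0,1,0]} }

/-- The simplex spanned by `±e₁`, `s • e₂` and `t • e₃`. -/
def axisSimplex (s t : ℝ) : Finset (Fin 3 → ℝ) :=
  {![1,0,0], ![-1,0,0], ![0,s,0], ![0,0,t]}

lemma mem_octaTri_iff {σ : Finset (Fin 3 → ℝ)} :
    σ ∈ octaTri ↔ ∃ s t : ℝ, (s = 1 ∨ s = -1) ∧ (t = 1 ∨ t = -1) ∧ σ = axisSimplex s t := by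
  have h₁ : ({![1,0,0], ![-1,0,0], ![0,0,1], ![0,-1,0]} : Finset (Fin 3 → ℝ)) =
      axisSimplex (-1) 1 := by
    rw [axisSimplex, Finset.pair_comm ![(0 : ℝ),0,1]]
  have h₂ : ({![1,0,0], ![-1,0,0], ![0,0,-1], ![0,1,0]} : Finset (Fin 3 → ℝ)) =
      axisSimplex 1 (-1) := by
    rw [axisSimplex, Finset.pair_comm ![(0 : ℝ),0,-1]]
  rw [octaTri, h₁, h₂]
  simp only [Finset.mem_insert, Finset.mem_singleton]
  constructor
  · rintro (h | h | h | h)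
    exacts [⟨1, 1, by simp [h, axisSimplex]⟩, ⟨-1, 1, by simp [h]⟩,
      ⟨-1, -1, by simp [h, axisSimplex]⟩, ⟨1, -1, by simp [h]⟩]
  · rintro ⟨s, t, rfl | rfl, rfl | rfl, rfl⟩ <;> simp [axisSimplex]

lemma mem_convexHull_of_axis {S : Set (Fin 3 → ℝ)} (hp : ![1,0,0] ∈ S) (hn : ![-1,0,0] ∈ S)
    {a y z s t : ℝ} (hy : 0 ≤ y) (hz : 0 ≤ z) (h : |a| + y + z ≤ 1)
    (hs : y ≠ 0 → ![0,s,0] ∈ S) (ht : z ≠ 0 → ![0,0,t] ∈ S) :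
    ![a, s * y, t * z] ∈ convexHull ℝ S := by
  have key : ∀ (c : ℝ) (v : Fin 3 → ℝ), (c ≠ 0 → v ∈ S) →
      ∃ w ∈ convexHull ℝ S, c • w = c • v := fun c v hv => by
    by_cases hc : c = 0
    · exact ⟨_, subset_convexHull ℝ S hp, by simp [hc]⟩
    · exact ⟨v, subset_convexHull ℝ S (hv hc), rfl⟩
  obtain ⟨v, hv, hv'⟩ := key y _ hs
  obtain ⟨w, hw, hw'⟩ := key z _ ht
  have ha := abs_le.1 (show |a| ≤ 1 - y - z by linarith)
  have := (convex_convexHull ℝ S).sum_mem (t := Finset.univ)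
    (w := ![(1 - y - z + a) / 2, (1 - y - z - a) / 2, y, z])
    (z := ![![1,0,0], ![-1,0,0], v, w])
    (by
      intro i _
      fin_cases i <;> simp <;> linarith)
    (by simp [Fin.sum_univ_four]; ring)
    (by
      intro i _
      fin_cases i
      exacts [subset_convexHull ℝ S hp, subset_convexHull ℝ S hn, hv, hw])
  convert this using 1
  simp only [Fin.sum_univ_four, Matrix.cons_val, hv', hw']
  ext i
  fin_cases i <;> simp <;> ring

lemma convexHull_axisSimplex_subset {s t : ℝ} (hs : s = 1 ∨ s = -1) (ht : t = 1 ∨ t = -1)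
    {x : Fin 3 → ℝ} (hx : x ∈ convexHull ℝ (axisSimplex s t : Set (Fin 3 → ℝ))) :
    0 ≤ s * x 1 ∧ 0 ≤ t * x 2 ∧ |x 0| + s * x 1 + t * x 2 ≤ 1 := by
  have hs' : s * s = 1 := by rcases hs with rfl | rfl <;> norm_num
  have ht' : t * t = 1 := by rcases ht with rfl | rfl <;> norm_num
  let C : Set (Fin 3 → ℝ) :=
    {x | 0 ≤ s * x 1 ∧ 0 ≤ t * x 2 ∧ |x 0| + s * x 1 + t * x 2 ≤ 1}
  have hC : Convex ℝ C := by
    rintro x ⟨h₁, h₂, h₃⟩ y ⟨k₁, k₂, k₃⟩ a b ha hb hab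
    simp only [C, Set.mem_ofPred_eq, Pi.add_apply, Pi.smul_apply, smul_eq_mul]
    have habs : |a * x 0 + b * y 0| ≤ a * |x 0| + b * |y 0| := by
      refine (abs_add_le _ _).trans ?_
      rw [abs_mul, abs_mul, abs_of_nonneg ha, abs_of_nonneg hb]
    refine ⟨?_, ?_, ?_⟩
    · nlinarith [mul_nonneg ha h₁, mul_nonneg hb k₁]
    · nlinarith [mul_nonneg ha h₂, mul_nonneg hb k₂]
    · nlinarith [mul_le_mul_of_nonneg_left h₃ ha, mul_le_mul_of_nonneg_left k₃ hb]
  refine convexHull_min ?_ hC hx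
  intro y hy
  simp only [axisSimplex, Finset.coe_insert, Finset.coe_singleton, Set.mem_insert_iff,
    Set.mem_singleton_iff] at hy
  rcases hy with rfl | rfl | rfl | rfl <;> simp [C, hs', ht']

lemma exists_sign_mul_eq (a : ℝ) : ∃ s : ℝ, (s = 1 ∨ s = -1) ∧ a = s * |a| := by
  rcases le_total 0 a with h | h
  · exact ⟨1, by simp, by simp [abs_of_nonneg h]⟩
  · exact ⟨-1, by simp, by simp [abs_of_nonpos h]⟩

lemma mem_octa_iff {x : Fin 3 → ℝ} : x ∈ octa ↔ ∑ i, |x i| ≤ 1 := by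
  constructor
  · intro hx
    have hC : Convex ℝ {x : Fin 3 → ℝ | ∑ i, |x i| ≤ 1} := by
      intro x hx y hy a b ha hb hab
      simp only [Set.mem_ofPred_eq, Pi.add_apply, Pi.smul_apply, smul_eq_mul] at *
      calc ∑ i, |a * x i + b * y i| ≤ ∑ i, (a * |x i| + b * |y i|) := by
            gcongr with i
            refine (abs_add_le _ _).trans ?_
            rw [abs_mul, abs_mul, abs_of_nonneg ha, abs_of_nonneg hb]
        _ = a * ∑ i, |x i| + b * ∑ i, |y i| := by
            rw [Finset.sum_add_distrib, Finset.mul_sum, Finset.mul_sum]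
        _ ≤ a * 1 + b * 1 := by gcongr
        _ = 1 := by linarith
    refine convexHull_min ?_ hC hx
    intro y hy
    simp only [octaVerts, Finset.coe_insert, Finset.coe_singleton, Set.mem_insert_iff,
      Set.mem_singleton_iff] at hy
    rcases hy with rfl | rfl | rfl | rfl | rfl | rfl <;> simp [Fin.sum_univ_three]
  · intro hx
    rw [Fin.sum_univ_three] at hx
    obtain ⟨s, hs, hs'⟩ := exists_sign_mul_eq (x 1)
    obtain ⟨t, ht, ht'⟩ := exists_sign_mul_eq (x 2)
    have hx' : x = ![x 0, s * |x 1|, t * |x 2|] := by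
      rw [← hs', ← ht']
      ext i
      fin_cases i <;> rfl
    rw [hx', octa]
    refine mem_convexHull_of_axis (by simp [octaVerts]) (by simp [octaVerts]) (abs_nonneg _)
      (abs_nonneg _) hx (fun _ => ?_) (fun _ => ?_)
    · rcases hs with rfl | rfl <;> simp [octaVerts]
    · rcases ht with rfl | rfl <;> simp [octaVerts]

lemma mem_latticePts_octa {x : Fin 3 → ℝ} (hx : x ∈ latticePts octa) :
    x = 0 ∨ x ∈ octaVerts := by
  obtain ⟨h, hl⟩ := hx
  rw [mem_octa_iff, Fin.sum_univ_three] at h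
  obtain ⟨a, ha⟩ := hl 0
  obtain ⟨b, hb⟩ := hl 1
  obtain ⟨c, hc⟩ := hl 2
  have hx' : x = ![(a : ℝ), b, c] := by
    ext i
    fin_cases i <;> assumption
  rw [ha, hb, hc] at h
  have h' : |a| + |b| + |c| ≤ 1 := by exact_mod_cast h
  have : (a = 0 ∧ b = 0 ∧ c = 0) ∨ (a = 1 ∧ b = 0 ∧ c = 0) ∨ (a = -1 ∧ b = 0 ∧ c = 0) ∨
      (a = 0 ∧ b = 1 ∧ c = 0) ∨ (a = 0 ∧ b = -1 ∧ c = 0) ∨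
      (a = 0 ∧ b = 0 ∧ c = 1) ∨ (a = 0 ∧ b = 0 ∧ c = -1) := by
    simp only [abs, max_def] at h'
    split_ifs at h' <;> omega
  subst hx'
  rcases this with ⟨rfl, rfl, rfl⟩ | ⟨rfl, rfl, rfl⟩ | ⟨rfl, rfl, rfl⟩ | ⟨rfl, rfl, rfl⟩ |
    ⟨rfl, rfl, rfl⟩ | ⟨rfl, rfl, rfl⟩ | ⟨rfl, rfl, rfl⟩ <;> simp [octaVerts]

lemma octaVerts_subset_latticePts : (octaVerts : Set (Fin 3 → ℝ)) ⊆ latticePts octa := by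
  intro x hx
  refine ⟨subset_convexHull ℝ _ hx, ?_⟩
  simp only [octaVerts, Finset.coe_insert, Finset.coe_singleton, Set.mem_insert_iff,
    Set.mem_singleton_iff] at hx
  have h₀ : ∃ n : ℤ, (0 : ℝ) = n := ⟨0, by simp⟩
  have h₁ : ∃ n : ℤ, (1 : ℝ) = n := ⟨1, by simp⟩
  have h₂ : ∃ n : ℤ, (-1 : ℝ) = n := ⟨-1, by simp⟩
  rcases hx with rfl | rfl | rfl | rfl | rfl | rfl <;> intro i <;> fin_cases i <;> assumption

lemma axisSimplex_subset_octaVerts {s t : ℝ} (hs : s = 1 ∨ s = -1) (ht : t = 1 ∨ t = -1) :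
    axisSimplex s t ⊆ octaVerts := by
  intro x hx
  simp only [axisSimplex, Finset.mem_insert, Finset.mem_singleton] at hx
  rcases hs with rfl | rfl <;> rcases ht with rfl | rfl <;>
    rcases hx with rfl | rfl | rfl | rfl <;> simp [octaVerts]

lemma card_axisSimplex {s t : ℝ} (hs : s ≠ 0) : (axisSimplex s t).card = 4 := by
  have h : (1 : ℝ) ≠ -1 := by norm_num
  simp [axisSimplex, Finset.card_insert_of_notMem, h, hs]

lemma affineIndependent_axisSimplex {s t : ℝ} (hs : s ≠ 0) (ht : t ≠ 0) :
    AffineIndependent ℝ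
      (fun p : (axisSimplex s t : Set (Fin 3 → ℝ)) => (p : Fin 3 → ℝ)) := by
  have h : AffineIndependent ℝ
      (![![1,0,0], ![-1,0,0], ![0,s,0], ![0,0,t]] : Fin 4 → Fin 3 → ℝ) := by
    rw [affineIndependent_iff_of_fintype]
    intro w hw hw'
    rw [Finset.univ.weightedVSub_eq_linear_combination hw] at hw'
    rw [Fin.sum_univ_four] at hw hw'
    have h0 := congrFun hw' 0
    have h1 := congrFun hw' 1
    have h2 := congrFun hw' 2
    simp at h0
    simp [hs] at h1
    simp [ht] at h2
    intro i
    fin_cases i <;> simp <;> linarith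
  have hr := h.range
  have : Set.range (![![1,0,0], ![-1,0,0], ![0,s,0], ![0,0,t]] : Fin 4 → Fin 3 → ℝ) =
      axisSimplex s t := by
    ext x
    simp [axisSimplex]
    tauto
  rwa [this] at hr

lemma isSolidLatticeTriangulation_octaTri : IsSolidLatticeTriangulation octa octaTri := by
  have hne : ∀ {s : ℝ}, s = 1 ∨ s = -1 → s ≠ 0 := by
    rintro s (rfl | rfl) <;> norm_num
  have habs : ∀ {s a : ℝ}, s = 1 ∨ s = -1 → 0 ≤ s * a → |a| = s * a ∧ a = s * (s * a) := by
    rintro s a (rfl | rfl) h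
    · simpa using h
    · simpa using h
  refine ⟨?_, ?_, ?_⟩
  · intro σ hσ
    obtain ⟨s, t, hs, ht, rfl⟩ := mem_octaTri_iff.1 hσ
    exact ⟨(Finset.coe_subset.2 (axisSimplex_subset_octaVerts hs ht)).trans
        octaVerts_subset_latticePts, card_axisSimplex (hne hs),
      affineIndependent_axisSimplex (hne hs) (hne ht)⟩
  · ext x
    simp only [Set.mem_iUnion, exists_prop]
    constructor
    · rintro ⟨σ, hσ, hx⟩
      obtain ⟨s, t, hs, ht, rfl⟩ := mem_octaTri_iff.1 hσ
      exact convexHull_mono (Finset.coe_subset.2 (axisSimplex_subset_octaVerts hs ht)) hx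
    · intro hx
      rw [mem_octa_iff, Fin.sum_univ_three] at hx
      obtain ⟨s, hs, hs'⟩ := exists_sign_mul_eq (x 1)
      obtain ⟨t, ht, ht'⟩ := exists_sign_mul_eq (x 2)
      have hx' : x = ![x 0, s * |x 1|, t * |x 2|] := by
        rw [← hs', ← ht']
        ext i
        fin_cases i <;> rfl
      refine ⟨axisSimplex s t, mem_octaTri_iff.2 ⟨s, t, hs, ht, rfl⟩, ?_⟩
      rw [hx']
      exact mem_convexHull_of_axis (by simp [axisSimplex]) (by simp [axisSimplex])
        (abs_nonneg _) (abs_nonneg _) hx (by simp [axisSimplex]) (by simp [axisSimplex])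
  · intro σ hσ τ hτ
    apply Set.Subset.antisymm
    · obtain ⟨s, t, hs, ht, rfl⟩ := mem_octaTri_iff.1 hσ
      obtain ⟨s', t', hs', ht', rfl⟩ := mem_octaTri_iff.1 hτ
      rintro x ⟨hx, hx'⟩
      obtain ⟨h₁, h₂, h₃⟩ := convexHull_axisSimplex_subset hs ht hx
      obtain ⟨k₁, k₂, -⟩ := convexHull_axisSimplex_subset hs' ht' hx'
      have hxe : x = ![x 0, s * (s * x 1), t * (t * x 2)] := by
        rw [← (habs hs h₁).2, ← (habs ht h₂).2]
        ext i
        fin_cases i <;> rfl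
      have hsign : ∀ {s s' a : ℝ}, s = 1 ∨ s = -1 → s' = 1 ∨ s' = -1 → 0 ≤ s * a →
          0 ≤ s' * a → s * a ≠ 0 → s = s' := by
        rintro s s' a (rfl | rfl) (rfl | rfl) h h' hn <;> first
          | rfl
          | exact absurd (by linarith) hn
      rw [hxe]
      refine mem_convexHull_of_axis (by simp [axisSimplex]) (by simp [axisSimplex]) h₁ h₂ h₃
        (fun hn => ?_) (fun hn => ?_)
      · simp [axisSimplex, hsign hs hs' h₁ k₁ hn]
      · simp [axisSimplex, hsign ht ht' h₂ k₂ hn]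
    · exact Set.subset_inter (convexHull_mono (by simp)) (convexHull_mono (by simp))

lemma segment_subset_convexHull_of_mem_octaTri {σ : Finset (Fin 3 → ℝ)} (hσ : σ ∈ octaTri) :
    segment ℝ ![1,0,0] (-![1,0,0]) ⊆ convexHull ℝ (σ : Set (Fin 3 → ℝ)) := by
  obtain ⟨s, t, -, -, rfl⟩ := mem_octaTri_iff.1 hσ
  exact segment_subset_convexHull (by simp [axisSimplex]) (by simp [axisSimplex])

lemma mem_of_mem_convexHull_of_lt {S : Set (Fin 3 → ℝ)} {v : Fin 3 → ℝ}
    (f : (Fin 3 → ℝ) →ₗ[ℝ] ℝ) (hf : ∀ x ∈ S, x ≠ v → f x < f v)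
    (hv : v ∈ convexHull ℝ S) : v ∈ S := by
  by_contra hvS
  have h : convexHull ℝ S ⊆ {x | f x < f v} :=
    convexHull_min (fun x hx => hf x hx (fun h => hvS (h ▸ hx)))
      (convex_halfSpace_lt f.isLinear _)
  exact lt_irrefl (f v) (h hv)

lemma neg_notMem_of_affineIndependent {σ : Finset (Fin 3 → ℝ)}
    (hσ : AffineIndependent ℝ (fun p : (σ : Set (Fin 3 → ℝ)) => (p : Fin 3 → ℝ)))
    {u v : Fin 3 → ℝ} (hu : u ∈ σ) (hu' : -u ∈ σ) (hv : v ∈ σ) (huv : v ≠ u)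
    (huv' : v ≠ -u) : -v ∉ σ := by
  intro hv'
  have hz : ∀ w : Fin 3 → ℝ, (0 : Fin 3 → ℝ) ∈
      convexHull ℝ (({w, -w} : Finset (Fin 3 → ℝ)) : Set (Fin 3 → ℝ)) := fun w => by
    rw [Finset.coe_pair, convexHull_pair]
    exact ⟨1 / 2, 1 / 2, by norm_num, by norm_num, by norm_num, by simp⟩
  have h := AffineIndependent.convexHull_inter (t₁ := {u, -u}) (t₂ := {v, -v}) hσ
    (by simp [Finset.insert_subset_iff, hu, hu']) (by simp [Finset.insert_subset_iff, hv, hv'])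
  have hd : (({u, -u} : Finset (Fin 3 → ℝ)) : Set (Fin 3 → ℝ)) ∩
      (({v, -v} : Finset (Fin 3 → ℝ)) : Set (Fin 3 → ℝ)) = ∅ := by
    rw [← Finset.coe_inter, Finset.coe_eq_empty, ← Finset.disjoint_iff_inter_eq_empty]
    have h₁ : u ≠ -v := fun h => huv' (by simp [h])
    have h₂ : -u ≠ -v := fun h => huv (neg_injective h.symm)
    simp [huv, huv', Ne.symm h₁, Ne.symm h₂]
  have h0 : (0 : Fin 3 → ℝ) ∈ convexHull ℝ ((({u, -u} : Finset (Fin 3 → ℝ)) : Set (Fin 3 → ℝ)) ∩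
      (({v, -v} : Finset (Fin 3 → ℝ)) : Set (Fin 3 → ℝ))) := by
    rw [h]
    exact ⟨hz u, hz v⟩
  rw [hd] at h0
  simp at h0

lemma mem_octaTri_of_segment_subset {σ : Finset (Fin 3 → ℝ)}
    (hl : (σ : Set (Fin 3 → ℝ)) ⊆ latticePts octa) (hc : σ.card = 4)
    (hi : AffineIndependent ℝ (fun p : (σ : Set (Fin 3 → ℝ)) => (p : Fin 3 → ℝ)))
    (hp : ![1,0,0] ∈ convexHull ℝ (σ : Set (Fin 3 → ℝ)))
    (hn : ![-1,0,0] ∈ convexHull ℝ (σ : Set (Fin 3 → ℝ))) : σ ∈ octaTri := by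
  have hmem : ∀ x ∈ σ, x = 0 ∨ x ∈ octaVerts := fun x hx => mem_latticePts_octa (hl hx)
  have hp' : ![1,0,0] ∈ σ := by
    refine mem_of_mem_convexHull_of_lt (LinearMap.proj 0) (fun x hx hne => ?_) hp
    have := hmem x hx
    simp only [octaVerts, Finset.mem_insert, Finset.mem_singleton] at this
    rcases this with rfl | rfl | rfl | rfl | rfl | rfl | rfl <;> first
      | exact absurd rfl hne
      | norm_num
  have hn' : ![-1,0,0] ∈ σ := by
    refine mem_of_mem_convexHull_of_lt (-LinearMap.proj 0) (fun x hx hne => ?_) hn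
    have := hmem x hx
    simp only [octaVerts, Finset.mem_insert, Finset.mem_singleton] at this
    rcases this with rfl | rfl | rfl | rfl | rfl | rfl | rfl <;> first
      | exact absurd rfl hne
      | norm_num
  have hanti : ∀ v ∈ σ, v 0 = 0 → -v ∉ σ := fun v hv hv0 =>
    neg_notMem_of_affineIndependent hi hp' (by simpa using hn') hv
      (by rintro rfl; simp at hv0) (by rintro rfl; simp at hv0)
  have h0 : (0 : Fin 3 → ℝ) ∉ σ := fun h => hanti 0 h rfl (by simpa using h)
  obtain ⟨s, hs, hs'⟩ : ∃ s : ℝ, (s = 1 ∨ s = -1) ∧ ![0,-s,0] ∉ σ := by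
    by_cases h : ![0,1,0] ∈ σ
    · exact ⟨1, by simp, by simpa using hanti _ h⟩
    · exact ⟨-1, by simp, by simpa using h⟩
  obtain ⟨t, ht, ht'⟩ : ∃ t : ℝ, (t = 1 ∨ t = -1) ∧ ![0,0,-t] ∉ σ := by
    by_cases h : ![0,0,1] ∈ σ
    · exact ⟨1, by simp, by simpa using hanti _ h⟩
    · exact ⟨-1, by simp, by simpa using h⟩
  refine mem_octaTri_iff.2 ⟨s, t, hs, ht, Finset.eq_of_subset_of_card_le ?_ ?_⟩
  · intro x hx
    have := hmem x hx
    simp only [octaVerts, Finset.mem_insert, Finset.mem_singleton] at this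
    rcases hs with rfl | rfl <;> rcases ht with rfl | rfl <;>
      rcases this with rfl | rfl | rfl | rfl | rfl | rfl | rfl <;>
      simp_all [axisSimplex]
  · rw [hc, card_axisSimplex]
    rcases hs with rfl | rfl <;> norm_num

lemma eq_octaTri_of_subset {𝒯 : Finset (Finset (Fin 3 → ℝ))} (h𝒯 : 𝒯 ⊆ octaTri)
    (hcov : octa ⊆ ⋃ σ ∈ 𝒯, convexHull ℝ (σ : Set (Fin 3 → ℝ))) : 𝒯 = octaTri := by
  refine Finset.Subset.antisymm h𝒯 fun σ hσ => ?_
  obtain ⟨s, t, hs, ht, rfl⟩ := mem_octaTri_iff.1 hσ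
  have hx : ![0, s / 3, t / 3] ∈ octa := by
    rw [mem_octa_iff, Fin.sum_univ_three]
    rcases hs with rfl | rfl <;> rcases ht with rfl | rfl <;> simp [abs_div] <;> norm_num
  obtain ⟨τ, hτ, hxτ⟩ : ∃ τ ∈ 𝒯, ![0, s / 3, t / 3] ∈ convexHull ℝ (τ : Set (Fin 3 → ℝ)) := by
    simpa using hcov hx
  obtain ⟨s', t', hs', ht', rfl⟩ := mem_octaTri_iff.1 (h𝒯 hτ)
  obtain ⟨h₁, h₂, -⟩ := convexHull_axisSimplex_subset hs' ht' hxτ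
  have hsign : ∀ {a b : ℝ}, a = 1 ∨ a = -1 → b = 1 ∨ b = -1 → 0 ≤ b * (a / 3) → a = b := by
    rintro a b (rfl | rfl) (rfl | rfl) h <;> first
      | rfl
      | norm_num at h
  rw [hsign hs hs' h₁, hsign ht ht' h₂]
  exact hτ

/-- The permutation of the coordinates of `ℝ³` induced by `π`. -/
def permCoord (π : Equiv.Perm (Fin 3)) : (Fin 3 → ℝ) ≃ₗ[ℝ] (Fin 3 → ℝ) :=
  LinearEquiv.funCongrLeft ℝ ℝ π

lemma permCoord_apply (π : Equiv.Perm (Fin 3)) (x : Fin 3 → ℝ) (i : Fin 3) :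
    permCoord π x i = x (π i) := rfl

lemma unimodularMap_permCoord (π : Equiv.Perm (Fin 3)) : UnimodularMap (permCoord π) := by
  refine ⟨π.permMatrix ℤ, ?_, fun x => ?_⟩
  · rw [Matrix.det_permutation]
    exact Units.isUnit _
  · ext i
    simp [permCoord_apply, Matrix.mulVec, dotProduct, PEquiv.toMatrix_apply]

lemma permCoord_mem_octa_iff (π : Equiv.Perm (Fin 3)) {x : Fin 3 → ℝ} :
    permCoord π x ∈ octa ↔ x ∈ octa := by
  simp only [mem_octa_iff, permCoord_apply]
  rw [Equiv.sum_comp π fun i => |x i|]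

lemma permCoord_image_octa (π : Equiv.Perm (Fin 3)) : permCoord π '' octa = octa := by
  ext x
  constructor
  · rintro ⟨y, hy, rfl⟩
    exact (permCoord_mem_octa_iff π).2 hy
  · intro hx
    refine ⟨(permCoord π).symm x, ?_, by simp⟩
    rw [← permCoord_mem_octa_iff π]
    simpa using hx

lemma exists_permCoord_eq {u : Fin 3 → ℝ} (hu : u ∈ octaVerts) :
    ∃ π : Equiv.Perm (Fin 3), permCoord π u = ![1,0,0] ∨ permCoord π u = ![-1,0,0] := by
  have key : ∀ (i : Fin 3), (∀ j, j ≠ i → u j = 0) → (u i = 1 ∨ u i = -1) →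
      ∃ π : Equiv.Perm (Fin 3), permCoord π u = ![1,0,0] ∨ permCoord π u = ![-1,0,0] := by
    intro i hi hui
    have hne : ∀ i : Fin 3, Equiv.swap 0 i 1 ≠ i ∧ Equiv.swap 0 i 2 ≠ i := by decide
    have h1 : u (Equiv.swap 0 i 1) = 0 := hi _ (hne i).1
    have h2 : u (Equiv.swap 0 i 2) = 0 := hi _ (hne i).2
    refine ⟨Equiv.swap 0 i, hui.imp (fun h => ?_) (fun h => ?_)⟩ <;> ext j <;> fin_cases j <;>
      simp [permCoord_apply, h, h1, h2]
  simp only [octaVerts, Finset.mem_insert, Finset.mem_singleton] at hu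
  rcases hu with rfl | rfl | rfl | rfl | rfl | rfl
  · exact key 0 (by simp [Fin.forall_fin_succ]) (by simp)
  · exact key 0 (by simp [Fin.forall_fin_succ]) (by simp)
  · exact key 1 (by simp [Fin.forall_fin_succ]) (by simp)
  · exact key 1 (by simp [Fin.forall_fin_succ]) (by simp)
  · exact key 2 (by simp [Fin.forall_fin_succ]) (by simp)
  · exact key 2 (by simp [Fin.forall_fin_succ]) (by simp)

lemma convexHull_image_permCoord (π : Equiv.Perm (Fin 3)) (σ : Finset (Fin 3 → ℝ)) :
    convexHull ℝ ((σ.image (permCoord π) : Finset (Fin 3 → ℝ)) : Set (Fin 3 → ℝ)) =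
      permCoord π '' convexHull ℝ (σ : Set (Fin 3 → ℝ)) := by
  rw [Finset.coe_image]
  exact ((permCoord π : (Fin 3 → ℝ) →ₗ[ℝ] (Fin 3 → ℝ)).image_convexHull _).symm

/-- The octahedron admits, up to lattice isomorphism, a unique lattice
point triangulation in which every 3-simplex contains an edge through the origin between
two antipodal vertices: the triangulation `octaTri` into four simplices all containing
the segment from `(1,0,0)` to `(-1,0,0)`. -/
theorem stmt16 :
    (IsSolidLatticeTriangulation octa octaTri ∧ HasAntipodalEdge octaTri) ∧
    (∀ 𝒯 : Finset (Finset (Fin 3 → ℝ)), IsSolidLatticeTriangulation octa 𝒯 →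
      HasAntipodalEdge 𝒯 →
      ∃ φ : (Fin 3 → ℝ) → (Fin 3 → ℝ), UnimodularMap φ ∧ φ '' octa = octa ∧
        Finset.image (fun σ => Finset.image φ σ) 𝒯 = octaTri) := by
  refine ⟨⟨isSolidLatticeTriangulation_octaTri, ![1,0,0], by simp [octaVerts],
    fun σ hσ => segment_subset_convexHull_of_mem_octaTri hσ⟩, ?_⟩
  rintro 𝒯 ⟨hsimp, hcov, -⟩ ⟨u, hu, hseg⟩
  obtain ⟨π, hπ⟩ := exists_permCoord_eq hu
  refine ⟨permCoord π, unimodularMap_permCoord π, permCoord_image_octa π,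
    eq_octaTri_of_subset ?_ ?_⟩
  · intro τ hτ
    obtain ⟨σ, hσ, rfl⟩ := Finset.mem_image.1 hτ
    obtain ⟨hl, hc, hi⟩ := hsimp σ hσ
    have hmem : permCoord π u ∈ permCoord π '' convexHull ℝ (σ : Set (Fin 3 → ℝ)) :=
      Set.mem_image_of_mem _ (hseg σ hσ (left_mem_segment ℝ u (-u)))
    have hmem' : -permCoord π u ∈ permCoord π '' convexHull ℝ (σ : Set (Fin 3 → ℝ)) := by
      rw [← map_neg]
      exact Set.mem_image_of_mem _ (hseg σ hσ (right_mem_segment ℝ u (-u)))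
    refine mem_octaTri_of_segment_subset ?_ ?_ ?_ ?_ ?_
    · rw [Finset.coe_image]
      rintro _ ⟨x, hx, rfl⟩
      exact ⟨(permCoord_mem_octa_iff π).2 (hl hx).1, fun i => (hl hx).2 (π i)⟩
    · rw [Finset.card_image_of_injective _ (permCoord π).injective, hc]
    · rw [Finset.coe_image]
      exact ((permCoord π).toAffineEquiv.affineIndependent_set_of_eq_iff).2 hi
    · rw [convexHull_image_permCoord]
      rcases hπ with h | h <;> rw [h] at hmem hmem'
      · exact hmem
      · simpa using hmem'
    · rw [convexHull_image_permCoord]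
      rcases hπ with h | h <;> rw [h] at hmem hmem'
      · simpa using hmem'
      · exact hmem
  · intro x hx
    rw [← permCoord_image_octa π, ← hcov] at hx
    obtain ⟨y, hy, rfl⟩ := hx
    obtain ⟨σ, hσ, hyσ⟩ : ∃ σ ∈ 𝒯, y ∈ convexHull ℝ (σ : Set (Fin 3 → ℝ)) := by simpa using hy
    refine Set.mem_biUnion (Finset.mem_coe.2 (Finset.mem_image_of_mem _ hσ)) ?_
    rw [convexHull_image_permCoord]
    exact Set.mem_image_of_mem _ hyσ

end SemistableTops
end
end
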